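/- Let F ∈ ℚ[x,y] have total degree 4, be irreducible over ℚ, and satisfy F(ℤ²) ⊆ ℤ_{≥0}. Then there is a constant c > 0 (depending on F) such that for all sufficiently large N, the number of integers in [1,N] that are values of F at integer points is at most c·N/√(log N). -/

import Mathlib

section

open Finset in
/-- bounded partial sums of `χ(a)/a` -/
lemma sum_chi_div_bound (χ : ℕ → ℝ) (M : ℝ)
    (hsum : ∀ z : ℕ, |∑ a ∈ Ioc 0 z, χ a| ≤ M) (z : ℕ) :
    |∑ a ∈ Ioc 0 z, χ a / a| ≤ M := by
  have hM : 0 ≤ M := le_trans (abs_nonneg _) (hsum 0)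
  have key : ∀ z : ℕ, |∑ a ∈ Ioc 0 z, χ a / a - (∑ a ∈ Ioc 0 z, χ a) / (z + 1)|
      ≤ M * (1 - 1 / (z + 1)) := by
    intro z
    induction z with
    | zero => simp
    | succ z ih =>
      have e1 : ∑ a ∈ Ioc 0 (z+1), χ a / a = ∑ a ∈ Ioc 0 z, χ a / a + χ (z+1) / (z+1) := by
        rw [Finset.sum_Ioc_succ_top (Nat.zero_le z)]; push_cast; rfl
      have e2 : ∑ a ∈ Ioc 0 z, χ a = ∑ a ∈ Ioc 0 (z+1), χ a - χ (z+1) := by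
        rw [Finset.sum_Ioc_succ_top (Nat.zero_le z)]; ring
      have hs := hsum (z+1)
      set S := ∑ a ∈ Ioc 0 (z+1), χ a with hS
      rw [e2] at ih
      rw [e1]
      set A := ∑ a ∈ Ioc 0 z, χ a / a
      have hz : (0:ℝ) < z + 1 := by positivity
      have hz2 : (0:ℝ) < (z:ℝ) + 1 + 1 := by positivity
      have e3 : A + χ (z+1) / (z+1) - S / (((z+1:ℕ):ℝ) + 1) =
          (A - (S - χ (z+1)) / (z+1)) + S * (1 / (z+1) - 1/(z+1+1)) := by
        push_cast; field_simp; ring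
      rw [e3]
      have hd : (0:ℝ) ≤ 1 / ((z:ℝ)+1) - 1/((z:ℝ)+1+1) := by
        rw [sub_nonneg]; apply one_div_le_one_div_of_le hz; linarith
      calc _ ≤ |A - (S - χ (z+1)) / (z+1)| + |S * (1 / ((z:ℝ)+1) - 1/((z:ℝ)+1+1))| := abs_add_le _ _
        _ ≤ M * (1 - 1 / (z + 1)) + M * (1 / ((z:ℝ)+1) - 1/((z:ℝ)+1+1)) := by
            rw [abs_mul, abs_of_nonneg hd]
            gcongr
        _ = _ := by push_cast; ring
  have h1 := key z
  have h2 := hsum z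
  have hz : (0:ℝ) < z + 1 := by positivity
  have h3 : |(∑ a ∈ Ioc 0 z, χ a) / (z + 1)| ≤ M * (1 / (z+1)) := by
    rw [abs_div, abs_of_pos hz, div_eq_mul_one_div]; gcongr
  have h4 := abs_add_le (∑ a ∈ Ioc 0 z, χ a / a - (∑ a ∈ Ioc 0 z, χ a) / (z + 1)) ((∑ a ∈ Ioc 0 z, χ a) / (z + 1))
  rw [sub_add_cancel] at h4
  linarith

/-- arithmetic function from a function -/
noncomputable def toAF (h : ℕ → ℝ) : ArithmeticFunction ℝ := ⟨fun n => if n = 0 then 0 else h n, by simp⟩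

lemma toAF_apply (h : ℕ → ℝ) {n : ℕ} (hn : n ≠ 0) : toAF h n = h n := by
  show (if n = 0 then 0 else h n) = h n
  simp [hn]

/-- structure of hypotheses on the character -/
structure QChar (χ : ℕ → ℝ) : Prop where
  map_one : χ 1 = 1
  map_mul : ∀ m n, χ (m * n) = χ m * χ n
  vals : ∀ n, χ n = 0 ∨ χ n = 1 ∨ χ n = -1
  bdd : ∃ M : ℝ, ∀ z : ℕ, |∑ a ∈ Finset.Ioc 0 z, χ a| ≤ M
  zeros : ∃ Z : Finset ℕ, ∀ p, p.Prime → χ p = 0 → p ∈ Z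

lemma QChar.map_pow {χ : ℕ → ℝ} (h : QChar χ) (p k : ℕ) : χ (p ^ k) = χ p ^ k := by
  induction k with
  | zero => simp [h.map_one]
  | succ k ih => rw [pow_succ, h.map_mul, ih, pow_succ]

lemma QChar.div_nonneg {χ : ℕ → ℝ} (h : QChar χ) (n : ℕ) (hn : n ≠ 0) :
    0 ≤ ∑ d ∈ n.divisors, χ d := by
  have hmul : (toAF χ).IsMultiplicative := by
    constructor
    · rw [toAF_apply _ one_ne_zero, h.map_one]
    · intro m n _
      rcases eq_or_ne m 0 with rfl | hm
      · simp
      rcases eq_or_ne n 0 with rfl | hn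
      · simp
      rw [toAF_apply _ hm, toAF_apply _ hn, toAF_apply _ (mul_ne_zero hm hn), h.map_mul]
  have hmul2 := (ArithmeticFunction.isMultiplicative_zeta.natCast (R := ℝ)).mul hmul
  have hval : ∀ n : ℕ, n ≠ 0 → ((ArithmeticFunction.zeta : ArithmeticFunction ℝ) * toAF χ) n = ∑ d ∈ n.divisors, χ d := by
    intro n hn
    rw [ArithmeticFunction.coe_zeta_mul_apply]
    refine Finset.sum_congr rfl fun d hd => toAF_apply _ ?_
    exact (Nat.pos_of_mem_divisors hd).ne'
  rw [← hval n hn, hmul2.multiplicative_factorization _ hn]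
  refine Finset.prod_nonneg fun p hp => ?_
  have hp' := Nat.prime_of_mem_primeFactors hp
  simp only
  rw [hval _ (pow_ne_zero _ hp'.ne_zero), Nat.sum_divisors_prime_pow hp']
  simp only [h.map_pow]
  rcases h.vals p with h0 | h0 | h0
  · exact Finset.sum_nonneg fun i _ => by rw [h0]; positivity
  · exact Finset.sum_nonneg fun i _ => by rw [h0]; positivity
  · rw [h0, neg_one_geom_sum]; split_ifs <;> norm_num

open Finset in
lemma QChar.sum_conv {χ : ℕ → ℝ} (h : QChar χ) : ∃ M : ℝ, 0 < M ∧ ∀ y : ℕ, 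
    ∑ n ∈ Ioc 0 y, (∑ d ∈ n.divisors, χ d) / n ≤ M * (1 + Real.log y) := by
  obtain ⟨M, hM⟩ := h.bdd
  have hM0 : 0 ≤ M := le_trans (abs_nonneg _) (hM 0)
  refine ⟨M + 1, by linarith, fun y => ?_⟩
  have e : ∑ n ∈ Ioc 0 y, (∑ d ∈ n.divisors, χ d) / n = 
      ∑ n ∈ Ioc 0 y, (toAF (fun n => (n:ℝ)⁻¹) * toAF (fun n => χ n / n)) n := by
    refine Finset.sum_congr rfl fun n hn => ?_
    rw [ArithmeticFunction.mul_apply, ← Nat.sum_divisorsAntidiagonal' (fun i j => χ j), Finset.sum_div]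
    refine Finset.sum_congr rfl fun p hp => ?_
    obtain ⟨hp1, hp2⟩ := Nat.mem_divisorsAntidiagonal.1 hp
    rw [← hp1] at hp2 ⊢
    rw [toAF_apply _ (left_ne_zero_of_mul hp2), toAF_apply _ (right_ne_zero_of_mul hp2)]
    push_cast
    rw [div_eq_mul_inv, mul_inv]; ring
  rw [e, ArithmeticFunction.sum_Ioc_mul_eq_sum_sum]
  have hh : ∑ n ∈ Ioc 0 y, (n:ℝ)⁻¹ ≤ 1 + Real.log y := by
    have := harmonic_le_one_add_log y
    rw [harmonic_eq_sum_Icc] at this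
    push_cast at this
    exact this
  have hh0 : 0 ≤ ∑ n ∈ Ioc 0 y, (n:ℝ)⁻¹ := by positivity
  calc _ ≤ ∑ n ∈ Ioc 0 y, (n:ℝ)⁻¹ * M := by
        refine Finset.sum_le_sum fun n hn => ?_
        have hn0 : n ≠ 0 := by simp at hn; omega
        rw [toAF_apply _ hn0]
        gcongr
        have := sum_chi_div_bound χ M hM (y / n)
        refine le_trans (le_of_eq ?_) (le_trans (le_abs_self _) this)
        refine Finset.sum_congr rfl fun m hm => toAF_apply _ ?_
        simp at hm; omega
    _ = (∑ n ∈ Ioc 0 y, (n:ℝ)⁻¹) * M := by rw [Finset.sum_mul]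
    _ ≤ (1 + Real.log y) * (M + 1) := by
        have : 0 ≤ 1 + Real.log y := hh0.trans hh
        gcongr
        linarith
    _ = _ := mul_comm _ _

/-- multiplicative monoid: no prime factor with χ p = -1, no prime factor in S -/
def TT (χ : ℕ → ℝ) (S : Finset ℕ) (m : ℕ) : Prop := ∀ p, p.Prime → p ∣ m → χ p ≠ -1 ∧ p ∉ S

lemma TT.chi_one {χ : ℕ → ℝ} (h : QChar χ) {S : Finset ℕ} (hS : ∀ p, p.Prime → χ p = 0 → p ∈ S) 
    (m : ℕ) (hm : m ≠ 0) (ht : TT χ S m) : χ m = 1 := by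
  induction m using Nat.recOnMul with
  | zero => exact absurd rfl hm
  | one => exact h.map_one
  | prime p hp => 
    obtain ⟨h1, h2⟩ := ht p hp dvd_rfl
    rcases h.vals p with h0 | h0 | h0
    · exact absurd (hS p hp h0) h2
    · exact h0
    · exact absurd h0 h1
  | mul a b iha ihb =>
    rw [h.map_mul, iha (left_ne_zero_of_mul hm) (fun p hp hd => ht p hp (hd.mul_right _)), 
      ihb (right_ne_zero_of_mul hm) (fun p hp hd => ht p hp (hd.mul_left _)), mul_one]

lemma TT.mul {χ : ℕ → ℝ} {S : Finset ℕ} {a b : ℕ} (ha : TT χ S a) (hb : TT χ S b) : TT χ S (a * b) := by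
  intro p hp hd
  rcases hp.dvd_mul.1 hd with h | h
  · exact ha p hp h
  · exact hb p hp h

lemma TT.of_dvd {χ : ℕ → ℝ} {S : Finset ℕ} {a b : ℕ} (ha : TT χ S b) (h : a ∣ b) : TT χ S a :=
  fun p hp hd => ha p hp (hd.trans h)

open Finset Classical in
lemma TT.sq_le {χ : ℕ → ℝ} (h : QChar χ) {S : Finset ℕ} (hS : ∀ p, p.Prime → χ p = 0 → p ∈ S) (x : ℕ) :
    (∑ k ∈ (Ioc 0 x).filter (TT χ S), (k:ℝ)⁻¹) ^ 2 ≤ 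
      ∑ n ∈ Ioc 0 (x ^ 2), (∑ d ∈ n.divisors, χ d) / n := by
  rw [sq, Finset.sum_mul_sum, ← Finset.sum_product']
  have hmaps : ∀ q ∈ (Ioc 0 x).filter (TT χ S) ×ˢ (Ioc 0 x).filter (TT χ S), q.1 * q.2 ∈ Ioc 0 (x^2) := by
    intro q hq
    simp only [mem_product, mem_filter, mem_Ioc] at hq ⊢
    refine ⟨Nat.mul_pos hq.1.1.1 hq.2.1.1, ?_⟩
    rw [sq]; exact Nat.mul_le_mul hq.1.1.2 hq.2.1.2
  rw [← Finset.sum_fiberwise_of_maps_to hmaps]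
  refine Finset.sum_le_sum fun n hn => ?_
  have hn0 : n ≠ 0 := by simp at hn; omega
  set Fb := ((Ioc 0 x).filter (TT χ S) ×ˢ (Ioc 0 x).filter (TT χ S)).filter (fun q => q.1 * q.2 = n) with hFb
  rcases Fb.eq_empty_or_nonempty with he | ⟨q, hq⟩
  · rw [he, Finset.sum_empty]
    exact div_nonneg (h.div_nonneg n hn0) (Nat.cast_nonneg _)
  · have hTn : TT χ S n := by
      simp only [hFb, mem_product, mem_filter, mem_Ioc] at hq
      rw [← hq.2]; exact hq.1.1.2.mul hq.1.2.2
    have h1 : ∑ i ∈ Fb, (i.1:ℝ)⁻¹ * (i.2:ℝ)⁻¹ = #Fb / n := by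
      rw [div_eq_mul_inv, ← nsmul_eq_mul]
      apply Finset.sum_eq_card_nsmul
      intro a ha
      have := (mem_filter.1 ha).2
      rw [← this]; push_cast; rw [mul_inv]
    have h2 : ∑ d ∈ n.divisors, χ d = #n.divisors := by
      rw [Finset.sum_congr rfl (g := fun _ => (1:ℝ)) ?_]
      · simp
      intro d hd
      exact TT.chi_one h hS d (Nat.pos_of_mem_divisors hd).ne' (hTn.of_dvd (Nat.dvd_of_mem_divisors hd))
    rw [h1, h2]
    gcongr
    refine Finset.card_le_card_of_injOn (fun q => q.1) ?_ ?_
    · intro q hq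
      have := (mem_filter.1 hq).2
      simp only [Finset.mem_coe, Nat.mem_divisors]
      exact ⟨⟨q.2, this.symm⟩, hn0⟩
    · intro q hq q' hq' he
      have e1 := (mem_filter.1 hq).2
      have e2 := (mem_filter.1 hq').2
      simp only at he
      have : q.1 ≠ 0 := by rintro h0; rw [h0, zero_mul] at e1; exact hn0 e1.symm
      refine Prod.ext he ?_
      rw [← he, ← e1] at e2
      exact (Nat.eq_of_mul_eq_mul_left (Nat.pos_of_ne_zero this) e2).symm

open Finset Classical in
lemma TT.insert_le {χ : ℕ → ℝ} {S : Finset ℕ} (p : ℕ) (hp : p.Prime) (x : ℕ) :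
    (∑ k ∈ (Ioc 0 x).filter (TT χ S), (k:ℝ)⁻¹) ≤ 
     2 * (∑ k ∈ (Ioc 0 x).filter (TT χ (insert p S)), (k:ℝ)⁻¹) := by
  have hsplit := Finset.sum_filter_add_sum_filter_not ((Ioc 0 x).filter (TT χ S)) (fun k => p ∣ k) (fun k => (k:ℝ)⁻¹)
  have h1 : ∑ k ∈ ((Ioc 0 x).filter (TT χ S)).filter (fun k => ¬ p ∣ k), (k:ℝ)⁻¹ ≤ 
      ∑ k ∈ (Ioc 0 x).filter (TT χ (insert p S)), (k:ℝ)⁻¹ := by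
    apply Finset.sum_le_sum_of_subset_of_nonneg
    · intro k hk
      simp only [mem_filter] at hk ⊢
      refine ⟨hk.1.1, fun q hq hd => ⟨(hk.1.2 q hq hd).1, ?_⟩⟩
      rw [mem_insert, not_or]
      refine ⟨?_, (hk.1.2 q hq hd).2⟩
      rintro rfl
      exact hk.2 hd
    · intros; positivity
  have h2 : ∑ k ∈ ((Ioc 0 x).filter (TT χ S)).filter (fun k => p ∣ k), (k:ℝ)⁻¹ ≤ 
      ∑ k ∈ (Ioc 0 x).filter (TT χ S), (p:ℝ)⁻¹ * (k:ℝ)⁻¹ := by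
    have hsub : ((Ioc 0 x).filter (TT χ S)).filter (fun k => p ∣ k) ⊆ 
        ((Ioc 0 x).filter (TT χ S)).image (fun k => p * k) := by
      intro k hk
      simp only [mem_filter, mem_Ioc] at hk
      obtain ⟨⟨⟨hk0, hkx⟩, hkT⟩, j, rfl⟩ := hk
      simp only [mem_image, mem_filter, mem_Ioc]
      refine ⟨j, ⟨⟨Nat.pos_of_mul_pos_left hk0, ?_⟩, hkT.of_dvd (dvd_mul_left _ _)⟩, rfl⟩
      exact le_trans (Nat.le_mul_of_pos_left _ hp.pos) hkx
    refine le_trans (Finset.sum_le_sum_of_subset_of_nonneg hsub (fun _ _ _ => by positivity)) ?_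
    rw [Finset.sum_image (fun a _ b _ hab => Nat.eq_of_mul_eq_mul_left hp.pos hab)]
    refine le_of_eq (Finset.sum_congr rfl fun k _ => ?_)
    push_cast; rw [mul_inv]
  rw [← Finset.mul_sum] at h2
  have h3 : (p:ℝ)⁻¹ ≤ 1/2 := by
    rw [← one_div]; apply one_div_le_one_div_of_le (by norm_num); exact_mod_cast hp.two_le
  have h4 : 0 ≤ ∑ k ∈ (Ioc 0 x).filter (TT χ S), (k:ℝ)⁻¹ := by positivity
  nlinarith

open Finset Classical in
lemma TT.recip_sum {χ : ℕ → ℝ} (h : QChar χ) : ∃ C : ℝ, 0 < C ∧ ∀ x : ℕ, 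
    (∑ k ∈ (Ioc 0 x).filter (TT χ ∅), (k:ℝ)⁻¹) ≤ C * Real.sqrt (1 + Real.log x) := by
  obtain ⟨Z, hZ⟩ := h.zeros
  obtain ⟨M, hM0, hM⟩ := h.sum_conv
  have hind : ∀ S : Finset ℕ, (∀ p ∈ S, p.Prime) → ∀ x : ℕ, (∑ k ∈ (Ioc 0 x).filter (TT χ ∅), (k:ℝ)⁻¹) ≤ 
      2 ^ (#S) * (∑ k ∈ (Ioc 0 x).filter (TT χ S), (k:ℝ)⁻¹) := by
    intro S
    induction S using Finset.induction_on with
    | empty => intro _ x; simp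
    | insert p S hpS ih => 
      intro hp x
      rw [Finset.card_insert_of_notMem hpS, pow_succ, mul_assoc]
      refine le_trans (ih (fun q hq => hp q (mem_insert_of_mem hq)) x) ?_
      gcongr
      exact TT.insert_le p (hp p (mem_insert_self _ _)) x
  set S := Z.filter Nat.Prime with hS
  have hS' : ∀ p, p.Prime → χ p = 0 → p ∈ S := fun p hp h0 => mem_filter.2 ⟨hZ p hp h0, hp⟩
  refine ⟨2 ^ (#S) * Real.sqrt (2 * M), by positivity, fun x => ?_⟩
  refine le_trans (hind S (fun p hp => (mem_filter.1 hp).2) x) ?_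
  rw [mul_assoc]
  gcongr
  rw [← Real.sqrt_mul (by positivity)]
  apply Real.le_sqrt_of_sq_le
  refine le_trans (TT.sq_le h hS' x) (le_trans (hM _) ?_)
  push_cast
  rw [Real.log_pow, mul_assoc, mul_left_comm]
  gcongr
  have : 0 ≤ Real.log x := Real.log_natCast_nonneg x
  push_cast
  linarith

open Finset Classical in
lemma TT.count {χ : ℕ → ℝ} (h : QChar χ) : ∃ C : ℝ, 0 < C ∧ ∀ Y : ℕ, 1 ≤ Y →
    (#((Ioc 0 Y).filter (TT χ ∅)) : ℝ) ≤ C * (Y / Real.sqrt (1 + Real.log Y)) := by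
  obtain ⟨C, hC0, hC⟩ := TT.recip_sum h
  refine ⟨(Real.log 4 + 6) * C, by positivity, fun Y hY => ?_⟩
  set T := (Ioc 0 Y).filter (TT χ ∅) with hT
  set R := ∑ k ∈ T, (k:ℝ)⁻¹ with hR
  have hYr : (1:ℝ) ≤ Y := by exact_mod_cast hY
  have hL : 0 ≤ Real.log Y := Real.log_natCast_nonneg Y
  have h1 : ∑ n ∈ T, Real.log n ≤ (Real.log 4 + 4) * Y * R := by
    have e1 : ∑ n ∈ T, Real.log n ≤ 
        ∑ n ∈ Ioc 0 Y, (toAF (fun n => if TT χ ∅ n then 1 else 0) * ArithmeticFunction.vonMangoldt) n := by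
      rw [hT, Finset.sum_filter]
      refine Finset.sum_le_sum fun n hn => ?_
      rw [ArithmeticFunction.mul_apply]
      have hnn : ∀ q ∈ n.divisorsAntidiagonal, 0 ≤ toAF (fun n => if TT χ ∅ n then 1 else 0) q.1 * ArithmeticFunction.vonMangoldt q.2 := by
        intro q hq
        refine mul_nonneg ?_ ArithmeticFunction.vonMangoldt_nonneg
        rw [toAF_apply _ (Nat.ne_zero_of_mem_divisorsAntidiagonal hq).1]
        split_ifs <;> norm_num
      split_ifs with ht
      · rw [← ArithmeticFunction.vonMangoldt_sum, ← Nat.sum_divisorsAntidiagonal' (fun i j => ArithmeticFunction.vonMangoldt j)]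
        refine Finset.sum_le_sum fun q hq => ?_
        rw [toAF_apply _ (Nat.ne_zero_of_mem_divisorsAntidiagonal hq).1, if_pos, one_mul]
        exact ht.of_dvd ⟨q.2, (Nat.mem_divisorsAntidiagonal.1 hq).1.symm⟩
      · exact Finset.sum_nonneg hnn
    refine e1.trans ?_
    rw [ArithmeticFunction.sum_Ioc_mul_eq_sum_sum, hR, hT, Finset.sum_filter, Finset.mul_sum]
    refine Finset.sum_le_sum fun n hn => ?_
    have hn0 : n ≠ 0 := by simp at hn; omega
    rw [toAF_apply _ hn0]
    split_ifs with ht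
    · have := Chebyshev.psi_le_const_mul_self (x := (Y:ℝ) / n) (by positivity)
      rw [Chebyshev.psi, Nat.floor_div_eq_div] at this
      rw [one_mul, mul_assoc, ← div_eq_mul_inv]
      exact this
    · simp
  have h2 : ∑ n ∈ T, (Real.log Y - Real.log n) ≤ Y * R := by
    rw [hR, Finset.mul_sum]
    refine Finset.sum_le_sum fun n hn => ?_
    have hn0 : n ≠ 0 := by simp [hT] at hn; omega
    have hn' : (n:ℝ) ≠ 0 := by exact_mod_cast hn0
    rw [← Real.log_div (by linarith) hn', ← div_eq_mul_inv]
    exact Real.log_le_self (by positivity)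
  have h3 : (#T : ℝ) ≤ Y * R := by
    rw [hR, Finset.mul_sum, Finset.card_eq_sum_ones]
    push_cast
    refine Finset.sum_le_sum fun n hn => ?_
    have hn0 : 0 < n ∧ n ≤ Y := by simp [hT] at hn; omega
    have h0 : (0:ℝ) < n := by exact_mod_cast hn0.1
    rw [← div_eq_mul_inv, le_div_iff₀ h0, one_mul]
    exact_mod_cast hn0.2
  rw [Finset.sum_sub_distrib, Finset.sum_const, nsmul_eq_mul] at h2
  have h4 : (#T:ℝ) * (1 + Real.log Y) ≤ (Real.log 4 + 6) * Y * R := by nlinarith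
  have h5 : R ≤ C * Real.sqrt (1 + Real.log Y) := hC Y
  have hs : 0 < Real.sqrt (1 + Real.log Y) := Real.sqrt_pos.2 (by linarith)
  have hs2 : Real.sqrt (1 + Real.log Y) * Real.sqrt (1 + Real.log Y) = 1 + Real.log Y := Real.mul_self_sqrt (by linarith)
  rw [← mul_div_assoc, le_div_iff₀ hs]
  have h6 : (Real.log 4 + 6) * Y * R ≤ (Real.log 4 + 6) * Y * (C * Real.sqrt (1 + Real.log Y)) := by gcongr
  rw [← hs2] at h4
  have h7 := h4.trans h6
  have : (#T:ℝ) * Real.sqrt (1 + Real.log Y) * Real.sqrt (1 + Real.log Y) ≤ ((Real.log 4 + 6) * C * Y) * Real.sqrt (1 + Real.log Y) := by linarith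
  exact le_of_mul_le_mul_right this hs

open NumberTheorySymbols in
/-- the quadratic character attached to `-d` -/
noncomputable def chiD (d : ℕ) (n : ℕ) : ℝ := if Even n then 0 else ((J(-(d:ℤ) | n) : ℤ) : ℝ)

lemma chiD_even {d n : ℕ} (h : Even n) : chiD d n = 0 := by simp [chiD, h]

open NumberTheorySymbols in
lemma chiD_odd {d n : ℕ} (h : Odd n) : chiD d n = ((J(-(d:ℤ) | n) : ℤ) : ℝ) := by
  simp [chiD, h]

lemma chiD_mul (d m n : ℕ) : chiD d (m * n) = chiD d m * chiD d n := by
  rcases Nat.even_or_odd m with hm | hm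
  · rw [chiD_even hm, chiD_even (hm.mul_right _), zero_mul]
  rcases Nat.even_or_odd n with hn | hn
  · rw [chiD_even hn, chiD_even (hn.mul_left _), mul_zero]
  rw [chiD_odd hm, chiD_odd hn, chiD_odd (hm.mul hn)]
  have : NeZero m := ⟨by rintro rfl; simp at hm⟩
  have : NeZero n := ⟨by rintro rfl; simp at hn⟩
  rw [jacobiSym.mul_right]; push_cast; rfl

lemma chiD_mod (d n : ℕ) : chiD d n = chiD d (n % (4 * d)) := by
  rcases Nat.even_or_odd n with hm | hm
  · rw [chiD_even hm, chiD_even ?_]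
    have := hm.two_dvd
    exact (Nat.dvd_mod_iff ⟨2 * d, by ring⟩).2 this |> even_iff_two_dvd.2
  · rw [chiD_odd hm, chiD_odd (hm.mod_even ⟨2 * d, by ring⟩), jacobiSym.mod_right _ hm]
    simp

lemma chiD_neg_one (d : ℕ) (hd : 0 < d) : chiD d (4 * d - 1) = -1 := by
  have hodd : Odd (4 * d - 1) := ⟨2 * d - 1, by omega⟩
  rw [chiD_odd hodd]
  have h2 : jacobiSym (2 ^ 2) (4 * d - 1) = 1 := by
    apply jacobiSym.sq_one'
    rw [Int.gcd_comm]
    have : Nat.Coprime (4 * d - 1) 2 := (Nat.coprime_two_right).2 hodd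
    simpa [Int.gcd] using this
  have h4 : jacobiSym (-(d:ℤ)) (4 * d - 1) = jacobiSym (-1) (4 * d - 1) := by
    have e : jacobiSym (-(d:ℤ)) (4 * d - 1) = jacobiSym (2^2 * (-(d:ℤ))) (4 * d - 1) := by
      rw [jacobiSym.mul_left, h2, one_mul]
    rw [e]
    apply jacobiSym.mod_left'
    apply Int.ModEq.eq
    apply Int.ModEq.symm
    rw [Int.modEq_iff_dvd]
    refine ⟨-1, ?_⟩
    have : ((4 * d - 1 : ℕ) : ℤ) = 4 * d - 1 := by omega
    rw [this]; ring
  rw [h4, jacobiSym.at_neg_one hodd, ZMod.χ₄_nat_three_mod_four (by omega)]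
  norm_num

lemma chiD_reflect (d n : ℕ) (hd : 0 < d) (hn : 0 < n) (hn' : n < 4 * d) : 
    chiD d (4 * d - n) = - chiD d n := by
  have h := chiD_mul d (4 * d - 1) n
  rw [chiD_neg_one d hd] at h
  have e : (4 * d - 1) * n % (4 * d) = 4 * d - n := by
    have : (4 * d - 1) * n = (4 * d - n) + (4 * d) * (n - 1) := by
      zify [show 1 ≤ 4 * d by omega, hn'.le, show 1 ≤ n by omega]; ring
    rw [this, Nat.add_mul_mod_self_left, Nat.mod_eq_of_lt (by omega)]
  rw [chiD_mod, e] at h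
  rw [h]; ring

lemma chiD_vals (d n : ℕ) : chiD d n = 0 ∨ chiD d n = 1 ∨ chiD d n = -1 := by
  rcases Nat.even_or_odd n with hm | hm
  · left; exact chiD_even hm
  · rw [chiD_odd hm]
    rcases jacobiSym.trichotomy (-(d:ℤ)) n with h | h | h <;> rw [h] <;> norm_num

open Finset in
lemma chiD_sum_period (d : ℕ) (hd : 0 < d) : ∑ a ∈ range (4 * d), chiD d a = 0 := by
  obtain ⟨q, hq⟩ : ∃ q, 4 * d = q + 1 := ⟨4 * d - 1, by omega⟩
  rw [hq, Finset.sum_range_succ', chiD_even (by simp : Even 0), add_zero]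
  have h1 := Finset.sum_range_reflect (fun j => chiD d (j + 1)) q
  have h2 : ∑ j ∈ range q, chiD d (q - 1 - j + 1) = ∑ j ∈ range q, - chiD d (j + 1) := by
    refine Finset.sum_congr rfl fun j hj => ?_
    rw [mem_range] at hj
    rw [← chiD_reflect d (j+1) hd (by omega) (by omega)]
    congr 1; omega

  rw [h2, Finset.sum_neg_distrib] at h1
  linarith

open Finset in
lemma chiD_sum_bdd (d : ℕ) (hd : 0 < d) (z : ℕ) : |∑ a ∈ range z, chiD d a| ≤ 4 * d := by
  induction z using Nat.strong_induction_on with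
  | _ z ih =>
    rcases lt_or_ge z (4 * d) with h | h
    · calc |∑ a ∈ range z, chiD d a| ≤ ∑ a ∈ range z, |chiD d a| := abs_sum_le_sum_abs _ _
        _ ≤ ∑ a ∈ range z, (1:ℝ) := by
            refine Finset.sum_le_sum fun a _ => ?_
            rcases chiD_vals d a with h | h | h <;> rw [h] <;> norm_num
        _ = z := by simp
        _ ≤ 4 * d := by exact_mod_cast h.le
    · obtain ⟨w, rfl⟩ := Nat.exists_eq_add_of_le h
      rw [Finset.sum_range_add, chiD_sum_period d hd, zero_add]
      have e : ∑ x ∈ range w, chiD d (4 * d + x) = ∑ x ∈ range w, chiD d x := by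
        refine Finset.sum_congr rfl fun x _ => ?_
        rw [chiD_mod, Nat.add_mod_left, ← chiD_mod]
      rw [e]
      exact ih w (by omega)

lemma chiD_qchar (d : ℕ) (hd : 0 < d) : QChar (chiD d) where
  map_one := by rw [chiD_odd odd_one]; simp
  map_mul := chiD_mul d
  vals := chiD_vals d
  bdd := by
    refine ⟨4 * d, fun z => ?_⟩
    have := chiD_sum_bdd d hd (z + 1)
    rw [Finset.sum_range_succ', chiD_even (by simp : Even 0), add_zero] at this
    rw [Finset.range_eq_Ico, Finset.sum_Ico_add' (fun k => chiD d k)] at this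
    exact this
  zeros := by
    refine ⟨insert 2 d.primeFactors, fun p hp h0 => ?_⟩
    rcases hp.eq_two_or_odd' with rfl | ho
    · simp
    · rw [chiD_odd ho] at h0
      have h0' : jacobiSym (-(d:ℤ)) p = 0 := by exact_mod_cast h0
      rw [jacobiSym.eq_zero_iff] at h0'
      have h1 := h0'.2
      rw [Finset.mem_insert]; right
      rw [Nat.mem_primeFactors]
      refine ⟨hp, ?_, hd.ne'⟩
      by_contra hnd
      apply h1
      have := (Nat.Prime.coprime_iff_not_dvd hp).2 hnd
      rw [Int.gcd_comm]
      simpa [Int.gcd] using this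

lemma chiD_prime_dvd (d p : ℕ) (hp : p.Prime) (u v : ℤ) (huv : IsCoprime u v)
    (h : (p:ℤ) ∣ u ^ 2 + d * v ^ 2) : chiD d p ≠ -1 := by
  rcases hp.eq_two_or_odd' with rfl | ho
  · rw [chiD_even (by simp)]; norm_num
  have : Fact p.Prime := ⟨hp⟩
  rw [chiD_odd ho]
  intro hc
  have hc' : jacobiSym (-(d:ℤ)) p = -1 := by exact_mod_cast hc
  rw [← jacobiSym.legendreSym.to_jacobiSym, legendreSym.eq_neg_one_iff] at hc'
  apply hc'
  have h' := (ZMod.intCast_zmod_eq_zero_iff_dvd _ p).2 h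
  push_cast at h'
  have hv : (v : ZMod p) ≠ 0 := by
    intro hv
    rw [hv] at h'
    have hu : (u : ZMod p) = 0 := by simpa using h'
    rw [ZMod.intCast_zmod_eq_zero_iff_dvd] at hu hv
    have := huv.isUnit_of_dvd' hu hv
    exact (Nat.prime_iff_prime_int.1 hp).not_isUnit this
  refine ⟨u / v, ?_⟩
  push_cast
  field_simp
  linear_combination -h'

open Finset Classical in
/-- Landau-type upper bound for values of `u² + d v²`. -/
theorem landau_upper (d : ℕ) (hd : 0 < d) : ∃ C : ℝ, 0 < C ∧ ∀ N : ℕ, 1 ≤ N →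
    (#((Ioc 0 N).filter (fun n : ℕ => ∃ u v : ℤ, (n:ℤ) = u ^ 2 + d * v ^ 2)) : ℝ) 
      ≤ C * (N / Real.sqrt (1 + Real.log N)) := by
  obtain ⟨C, hC0, hC⟩ := TT.count (chiD_qchar d hd)
  have hsumm : Summable (fun e : ℕ => Real.sqrt e / (e:ℝ)^2) := by
    have := Real.summable_nat_rpow_inv (p := 3/2)
    refine (this.2 (by norm_num)).congr fun e => ?_
    rcases Nat.eq_zero_or_pos e with rfl | he
    · simp
    have he' : (0:ℝ) < e := by exact_mod_cast he
    rw [Real.sqrt_eq_rpow, ← Real.rpow_natCast, ← Real.rpow_sub he', ← Real.rpow_neg he'.le]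
    norm_num
  set B := ∑' e : ℕ, Real.sqrt e / (e:ℝ)^2 with hB
  have hB0 : 0 ≤ B := tsum_nonneg fun e => by positivity
  refine ⟨C * Real.sqrt 2 * (B + 1), by positivity, fun N hN => ?_⟩
  set T : ℕ → Finset ℕ := fun Y => (Ioc 0 Y).filter (TT (chiD d) ∅) with hT
  have hsub : (Ioc 0 N).filter (fun n : ℕ => ∃ u v : ℤ, (n:ℤ) = u ^ 2 + d * v ^ 2) ⊆ 
      (Ioc 0 N).biUnion (fun e => (T (N / e ^ 2)).image (fun m : ℕ => e ^ 2 * m)) := by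
    intro n hn
    simp only [mem_filter, mem_Ioc] at hn
    obtain ⟨⟨hn0, hnN⟩, u, v, huv⟩ := hn
    have hg : Int.gcd u v ≠ 0 := by
      intro h0
      rw [Int.gcd_eq_zero_iff] at h0
      rw [h0.1, h0.2] at huv
      simp at huv; omega
    obtain ⟨u', v', hcop, hu, hv⟩ := Int.exists_gcd_one (Nat.pos_of_ne_zero hg)
    set e := Int.gcd u v with he
    have hcop' : IsCoprime u' v' := Int.isCoprime_iff_gcd_eq_one.2 hcop
    have hm0 : 0 ≤ u' ^ 2 + d * v' ^ 2 := by positivity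
    obtain ⟨m, hm⟩ := Int.eq_ofNat_of_zero_le hm0
    have hnm : n = e ^ 2 * m := by
      zify
      rw [huv, ← hm, hu, hv]; ring
    have hm1 : 0 < m := Nat.pos_of_ne_zero (by rintro rfl; simp at hnm; omega)
    have he1 : 0 < e := Nat.pos_of_ne_zero hg
    simp only [mem_biUnion, mem_image, mem_Ioc, hT, mem_filter]
    refine ⟨e, ⟨he1, ?_⟩, m, ⟨⟨hm1, ?_⟩, ?_⟩, hnm.symm⟩
    · refine le_trans ?_ hnN
      rw [hnm, sq, mul_assoc]
      exact Nat.le_mul_of_pos_right _ (Nat.mul_pos he1 hm1)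
    · rw [Nat.le_div_iff_mul_le (by positivity), mul_comm, ← hnm]; exact hnN
    · intro p hp hpd
      refine ⟨chiD_prime_dvd d p hp u' v' hcop' ?_, by simp⟩
      rw [hm]; exact_mod_cast hpd
  have hNr : (1:ℝ) ≤ N := by exact_mod_cast hN
  have hLN : 0 ≤ Real.log N := Real.log_natCast_nonneg N
  have hsN : 0 < Real.sqrt (1 + Real.log N) := Real.sqrt_pos.2 (by linarith)
  have hterm : ∀ e ∈ Ioc 0 N, (#(T (N / e ^ 2)) : ℝ) ≤ 
      C * Real.sqrt 2 * (N / Real.sqrt (1 + Real.log N)) * (Real.sqrt e / (e:ℝ)^2) := by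
    intro e he
    rw [mem_Ioc] at he
    have he1 : (1:ℝ) ≤ e := by exact_mod_cast he.1
    rcases Nat.eq_zero_or_pos (N / e ^ 2) with h0 | h0
    · rw [h0]; simp [hT]; positivity
    set Y := N / e ^ 2 with hY
    have hY1 : (1:ℝ) ≤ Y := by exact_mod_cast h0
    have hYle : (Y:ℝ) * e ^ 2 ≤ N := by
      exact_mod_cast Nat.div_mul_le_self N (e ^ 2)
    have hYge : (N:ℝ) ≤ Y * (2 * e ^ 2) := by
      have : N < (Y + 1) * e ^ 2 := by
        have := Nat.lt_div_mul_add (a := N) (b := e ^ 2) (by have := he.1; positivity)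
        rw [← hY] at this; linarith
      have h' : (N:ℝ) < (Y + 1) * e ^ 2 := by exact_mod_cast this
      nlinarith [sq_nonneg (e:ℝ)]
    have hLY : 0 ≤ Real.log Y := Real.log_natCast_nonneg Y
    have hlog : 1 + Real.log N ≤ (1 + Real.log Y) * (2 * e) := by
      have l1 : Real.log N ≤ Real.log Y + (Real.log 2 + 2 * Real.log e) := by
        have := Real.log_le_log (by linarith) hYge
        rwa [Real.log_mul (by linarith) (by positivity), Real.log_mul (by norm_num) (by positivity), Real.log_pow] at this
      have l2 : Real.log e ≤ e - 1 := Real.log_le_sub_one_of_pos (by linarith)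
      have l3 : Real.log 2 ≤ 1 := by linarith [Real.log_le_sub_one_of_pos (show (0:ℝ) < 2 by norm_num)]
      nlinarith
    have hsY : 0 < Real.sqrt (1 + Real.log Y) := Real.sqrt_pos.2 (by linarith)
    have hs : Real.sqrt (1 + Real.log N) ≤ Real.sqrt (1 + Real.log Y) * (Real.sqrt 2 * Real.sqrt e) := by
      rw [← Real.sqrt_mul (by norm_num), ← Real.sqrt_mul (by linarith)]
      exact Real.sqrt_le_sqrt hlog
    refine (hC Y h0).trans ?_
    rw [show C * Real.sqrt 2 * (N / Real.sqrt (1 + Real.log N)) * (Real.sqrt e / (e:ℝ)^2) = 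
      C * ((N * Real.sqrt 2 * Real.sqrt e) / (Real.sqrt (1 + Real.log N) * (e:ℝ)^2)) by field_simp]
    gcongr C * ?_
    rw [div_le_div_iff₀ hsY (by positivity)]
    calc (Y:ℝ) * (Real.sqrt (1 + Real.log N) * (e:ℝ)^2) = (Y * (e:ℝ)^2) * Real.sqrt (1 + Real.log N) := by ring
      _ ≤ N * (Real.sqrt (1 + Real.log Y) * (Real.sqrt 2 * Real.sqrt e)) := by gcongr
      _ = _ := by ring
  calc (#((Ioc 0 N).filter (fun n : ℕ => ∃ u v : ℤ, (n:ℤ) = u ^ 2 + d * v ^ 2)) : ℝ)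
      ≤ ∑ e ∈ Ioc 0 N, (#(T (N / e ^ 2)) : ℝ) := by
        refine le_trans (Nat.cast_le.2 (Finset.card_le_card hsub)) ?_
        refine le_trans (Nat.cast_le.2 Finset.card_biUnion_le) ?_
        push_cast
        exact Finset.sum_le_sum fun e _ => Nat.cast_le.2 Finset.card_image_le
    _ ≤ ∑ e ∈ Ioc 0 N, C * Real.sqrt 2 * (N / Real.sqrt (1 + Real.log N)) * (Real.sqrt e / (e:ℝ)^2) := 
        Finset.sum_le_sum hterm
    _ = C * Real.sqrt 2 * (N / Real.sqrt (1 + Real.log N)) * ∑ e ∈ Ioc 0 N, (Real.sqrt e / (e:ℝ)^2) := by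
        rw [Finset.mul_sum]
    _ ≤ C * Real.sqrt 2 * (N / Real.sqrt (1 + Real.log N)) * (B + 1) := by
        gcongr
        have := hsumm.sum_le_tsum (Ioc 0 N) (fun e _ => by positivity)
        linarith
    _ = _ := by ring

end

section

/-- sets of integers with few elements up to `t^4` -/
def SmallSet (V : Set ℤ) : Prop :=
  ∃ C : ℝ, 0 < C ∧ ∀ t : ℝ, 1 ≤ t → (({m ∈ V | 1 ≤ m ∧ (m:ℝ) ≤ t ^ 4}).ncard : ℝ) ≤ C * t ^ 3

/-- sets of integers satisfying the desired bound -/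
def GoodSet (V : Set ℤ) : Prop :=
  ∃ C : ℝ, 0 < C ∧ ∀ N : ℕ, 1 ≤ N → 
    (({m ∈ V | 1 ≤ m ∧ m ≤ (N:ℤ)}).ncard : ℝ) ≤ C * (N / Real.sqrt (1 + Real.log N))

lemma slice_finite (V : Set ℤ) (s : ℝ) : ({m ∈ V | 1 ≤ m ∧ (m:ℝ) ≤ s}).Finite := by
  refine (Set.finite_Icc (1:ℤ) ⌊s⌋).subset ?_
  rintro m ⟨_, h1, h2⟩
  exact ⟨h1, Int.le_floor.2 h2⟩

lemma slice_finite' (V : Set ℤ) (s : ℤ) : ({m ∈ V | 1 ≤ m ∧ m ≤ s}).Finite := by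
  refine (Set.finite_Icc (1:ℤ) s).subset ?_
  rintro m ⟨_, h1, h2⟩
  exact ⟨h1, h2⟩

lemma SmallSet.mono {V W : Set ℤ} (hW : SmallSet W) (h : V ⊆ W) : SmallSet V := by
  obtain ⟨C, hC, hb⟩ := hW
  refine ⟨C, hC, fun t ht => le_trans ?_ (hb t ht)⟩
  have hs : {m ∈ V | 1 ≤ m ∧ (m:ℝ) ≤ t ^ 4} ⊆ {m ∈ W | 1 ≤ m ∧ (m:ℝ) ≤ t ^ 4} := fun m hm => ⟨h hm.1, hm.2⟩
  exact_mod_cast Set.ncard_le_ncard hs (slice_finite W _)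

lemma GoodSet.mono {V W : Set ℤ} (hW : GoodSet W) (h : V ⊆ W) : GoodSet V := by
  obtain ⟨C, hC, hb⟩ := hW
  refine ⟨C, hC, fun t ht => le_trans ?_ (hb t ht)⟩
  have hs : {m ∈ V | 1 ≤ m ∧ m ≤ (t:ℤ)} ⊆ {m ∈ W | 1 ≤ m ∧ m ≤ (t:ℤ)} := fun m hm => ⟨h hm.1, hm.2⟩
  exact_mod_cast Set.ncard_le_ncard hs (slice_finite' W _)

lemma SmallSet.union {V W : Set ℤ} (hV : SmallSet V) (hW : SmallSet W) : SmallSet (V ∪ W) := by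
  obtain ⟨C, hC, hb⟩ := hV
  obtain ⟨D, hD, hd⟩ := hW
  refine ⟨C + D, by positivity, fun t ht => ?_⟩
  have e : {m ∈ V ∪ W | 1 ≤ m ∧ (m:ℝ) ≤ t ^ 4} = {m ∈ V | 1 ≤ m ∧ (m:ℝ) ≤ t ^ 4} ∪ {m ∈ W | 1 ≤ m ∧ (m:ℝ) ≤ t ^ 4} := by
    ext m; simp only [Set.mem_union, Set.mem_ofPred_eq]; tauto
  have h1 : (({m ∈ V ∪ W | 1 ≤ m ∧ (m:ℝ) ≤ t ^ 4}).ncard : ℝ) ≤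
      (({m ∈ V | 1 ≤ m ∧ (m:ℝ) ≤ t ^ 4}).ncard : ℝ) + (({m ∈ W | 1 ≤ m ∧ (m:ℝ) ≤ t ^ 4}).ncard : ℝ) := by
    rw [e]; exact_mod_cast Set.ncard_union_le _ _
  have := hb t ht
  have := hd t ht
  linarith

lemma SmallSet.empty : SmallSet ∅ := ⟨1, one_pos, fun t ht => by simp; positivity⟩

lemma SmallSet.biUnion {ι : Type*} (s : Finset ι) (V : ι → Set ℤ) (h : ∀ i ∈ s, SmallSet (V i)) :
    SmallSet (⋃ i ∈ s, V i) := by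
  classical
  induction s using Finset.induction_on with
  | empty => simpa using SmallSet.empty
  | insert a s ha ih =>
    rw [Finset.set_biUnion_insert]
    exact (h a (Finset.mem_insert_self _ _)).union (ih fun i hi => h i (Finset.mem_insert_of_mem hi))

lemma SmallSet.good {V : Set ℤ} (hV : SmallSet V) : GoodSet V := by
  obtain ⟨C, hC, hb⟩ := hV
  refine ⟨2 * C, by positivity, fun N hN => ?_⟩
  have hN1 : (1:ℝ) ≤ N := by exact_mod_cast hN
  set t : ℝ := Real.sqrt (Real.sqrt N) with ht
  have ht1 : 1 ≤ t := Real.one_le_sqrt.2 (Real.one_le_sqrt.2 hN1)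
  have ht4 : t ^ 4 = N := by
    rw [show t ^ 4 = (t ^ 2) ^ 2 by ring, ht, Real.sq_sqrt (Real.sqrt_nonneg _), Real.sq_sqrt (by linarith)]
  have h1 := hb t ht1
  have e : {m ∈ V | 1 ≤ m ∧ (m:ℝ) ≤ t ^ 4} = {m ∈ V | 1 ≤ m ∧ m ≤ (N:ℤ)} := by
    ext m
    simp only [Set.mem_ofPred_eq, ht4]
    have : (m:ℝ) ≤ (N:ℝ) ↔ m ≤ (N:ℤ) := by exact_mod_cast Iff.rfl
    rw [this]
  rw [e] at h1
  refine h1.trans ?_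
  have hlog : 1 + Real.log N ≤ (2 * t) ^ 2 := by
    rw [← ht4, Real.log_pow]
    have := Real.log_le_sub_one_of_pos (show 0 < t by linarith)
    push_cast
    nlinarith
  have hs : Real.sqrt (1 + Real.log N) ≤ 2 * t := by
    rw [Real.sqrt_le_left (by linarith)]; exact hlog
  have hL : 0 ≤ Real.log N := Real.log_natCast_nonneg N
  have hs0 : 0 < Real.sqrt (1 + Real.log N) := Real.sqrt_pos.2 (by linarith)
  rw [← mul_div_assoc, le_div_iff₀ hs0]
  calc C * t ^ 3 * Real.sqrt (1 + Real.log N) ≤ C * t ^ 3 * (2 * t) := by gcongr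
    _ = 2 * C * t ^ 4 := by ring
    _ = 2 * C * N := by rw [ht4]

/-- integers near β -/
noncomputable def near (β R : ℝ) : Finset ℤ := Finset.Icc ⌈β - R⌉ ⌊β + R⌋

lemma mem_near {β R : ℝ} {y : ℤ} : y ∈ near β R ↔ |(y:ℝ) - β| ≤ R := by
  rw [near, Finset.mem_Icc, Int.ceil_le, Int.le_floor, abs_le]
  constructor <;> rintro ⟨h1, h2⟩ <;> constructor <;> linarith

lemma card_near {β R : ℝ} (hR : 0 ≤ R) : ((near β R).card : ℝ) ≤ 2 * R + 1 := by
  rw [near, Int.card_Icc]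
  rcases le_total 0 (⌊β + R⌋ + 1 - ⌈β - R⌉) with h | h
  · have e : (((⌊β + R⌋ + 1 - ⌈β - R⌉).toNat : ℤ) : ℝ) = ((⌊β + R⌋ + 1 - ⌈β - R⌉ : ℤ) : ℝ) := by
      rw [Int.toNat_of_nonneg h]
    rw [Int.cast_natCast] at e
    rw [e]; push_cast
    have := Int.floor_le (β + R)
    have := Int.le_ceil (β - R)
    linarith
  · rw [Int.toNat_of_nonpos h]; simp; linarith

lemma ncard_cover (W : Set ℤ) (X : Finset ℤ) (Y : ℤ → Finset ℤ) (G : ℤ → ℤ → ℝ) (A B : ℝ)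
    (hcov : ∀ m ∈ W, ∃ x ∈ X, ∃ y ∈ Y x, G x y = m)
    (hA : (X.card : ℝ) ≤ A) (hB : ∀ x ∈ X, ((Y x).card : ℝ) ≤ B) (hB0 : 0 ≤ B) : (W.ncard : ℝ) ≤ A * B := by
  classical
  set U := X.biUnion (fun x => (Y x).image (fun y => ⌊G x y⌋)) with hU
  have hsub : W ⊆ U := by
    intro m hm
    obtain ⟨x, hx, y, hy, h⟩ := hcov m hm
    simp only [hU, Finset.coe_biUnion, Set.mem_iUnion, Finset.mem_coe, Finset.mem_image]
    exact ⟨x, hx, y, hy, by rw [h]; simp⟩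
  have h1 : (W.ncard : ℝ) ≤ U.card := by
    have := Set.ncard_le_ncard hsub (Finset.finite_toSet U)
    rw [Set.ncard_coe_finset] at this
    exact_mod_cast this
  refine h1.trans ?_
  refine le_trans (Nat.cast_le.2 Finset.card_biUnion_le) ?_
  push_cast
  calc _ ≤ ∑ x ∈ X, B := Finset.sum_le_sum fun x hx => 
        le_trans (Nat.cast_le.2 Finset.card_image_le) (hB x hx)
    _ = X.card * B := by rw [Finset.sum_const, nsmul_eq_mul]
    _ ≤ A * B := by gcongr

open Polynomial Filter in
lemma poly_growth (P : ℝ[X]) (k : ℕ) (hk : k ≤ P.natDegree) (hP : P ≠ 0) : 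
    ∃ K : ℝ, 0 < K ∧ ∀ x : ℝ, K ≤ |x| → |x| ^ k ≤ K * |P.eval x| := by
  have aux : ∀ P : ℝ[X], k ≤ P.natDegree → P ≠ 0 → ∃ K : ℝ, 0 < K ∧ ∀ x : ℝ, K ≤ x → |x| ^ k ≤ K * |P.eval x| := by
    intro P hk hP
    have hdeg : (X ^ k : ℝ[X]).degree ≤ P.degree := by
      rw [degree_X_pow]; rw [Polynomial.degree_eq_natDegree hP]; exact_mod_cast hk
    have hO := Polynomial.isBigO_atTop_of_degree_le (X ^ k) P hdeg
    obtain ⟨c, hc0, hc⟩ := hO.exists_pos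
    rw [Asymptotics.isBigOWith_iff] at hc
    obtain ⟨a, ha⟩ := eventually_atTop.1 hc
    refine ⟨max c a, lt_max_of_lt_left hc0, fun x hx => ?_⟩
    have := ha x (le_trans (le_max_right _ _) hx)
    simp only [eval_pow, eval_X, norm_pow, Real.norm_eq_abs] at this
    refine this.trans ?_
    gcongr
    exact le_max_left _ _
  obtain ⟨K1, h1, h1'⟩ := aux P hk hP
  obtain ⟨K2, h2, h2'⟩ := aux (P.comp (-X)) (by rw [natDegree_comp]; simpa using hk) (by
    intro h0
    apply hP
    have := congrArg (fun q => q.comp (-X)) h0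
    simpa [comp_assoc] using this)
  refine ⟨max K1 K2, lt_max_of_lt_left h1, fun x hx => ?_⟩
  rcases le_abs.1 hx with h | h
  · refine (h1' x (le_trans (le_max_left _ _) h)).trans ?_
    gcongr; exact le_max_left _ _
  · have := h2' (-x) (le_trans (le_max_right _ _) h)
    simp only [eval_comp, eval_neg, eval_X, neg_neg, abs_neg] at this
    refine this.trans ?_
    gcongr; exact le_max_right _ _

open Polynomial Filter in
lemma lead_nonneg (P : ℝ[X]) (h : ∀ n : ℕ, 0 ≤ P.eval (n:ℝ)) : 0 ≤ P.leadingCoeff := by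
  by_contra! hlt
  rcases Nat.eq_zero_or_pos P.natDegree with h0 | h0
  · rw [Polynomial.eq_C_of_natDegree_eq_zero h0] at hlt h
    have := h 0
    simp at hlt this
    linarith
  · have ht := P.tendsto_atBot_of_leadingCoeff_nonpos (natDegree_pos_iff_degree_pos.1 h0) hlt.le
    have ht2 := ht.comp tendsto_natCast_atTop_atTop
    obtain ⟨n, hn⟩ := (ht2.eventually (eventually_lt_atBot 0)).exists
    exact absurd (h n) (not_le.2 hn)

open Polynomial Filter in
lemma even_natDegree (P : ℝ[X]) (h : ∀ n : ℤ, 0 ≤ P.eval (n:ℝ)) : Even P.natDegree := by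
  by_contra hodd
  rw [Nat.not_even_iff_odd] at hodd
  have h1 := lead_nonneg P (fun n => by simpa using h n)
  have h2 := lead_nonneg (P.comp (-X)) (fun n => by simpa using h (-n))
  rw [leadingCoeff_comp (by simp)] at h2
  simp [hodd.neg_one_pow] at h2
  have h3 : P.leadingCoeff = 0 := by linarith
  rw [leadingCoeff_eq_zero] at h3
  rw [h3] at hodd
  simp at hodd

open Polynomial in
lemma small_poly (P : ℝ[X]) (hd : 2 ≤ P.natDegree) : SmallSet {m : ℤ | ∃ j : ℤ, P.eval (j:ℝ) = m} := by
  obtain ⟨K, hK, h⟩ := poly_growth P 2 hd (by rintro rfl; simp at hd)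
  refine ⟨2 * (K + 1) + 1, by positivity, fun t ht => ?_⟩
  have := ncard_cover {m ∈ {m : ℤ | ∃ j : ℤ, P.eval (j:ℝ) = m} | 1 ≤ m ∧ (m:ℝ) ≤ t ^ 4} 
    (near 0 ((K + 1) * t ^ 2)) (fun _ => {0}) (fun x _ => P.eval (x:ℝ)) (2 * ((K + 1) * t ^ 2) + 1) 1 ?_ 
    (card_near (by positivity)) (by simp) zero_le_one
  · refine this.trans ?_
    have h1 : t ^ 2 ≤ t ^ 3 := pow_le_pow_right₀ ht (by norm_num)
    have h2 : 1 ≤ t ^ 3 := one_le_pow₀ ht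
    nlinarith
  · rintro m ⟨⟨j, hj⟩, hm1, hm2⟩
    refine ⟨j, mem_near.2 ?_, 0, by simp, hj⟩
    rw [sub_zero]
    have ht2 : 1 ≤ t ^ 2 := one_le_pow₀ ht
    rcases le_total K |(j:ℝ)| with hc | hc
    · have h3 := h j hc
      have hm0 : (1:ℝ) ≤ m := by exact_mod_cast hm1
      rw [hj, abs_of_pos (show (0:ℝ) < m by linarith)] at h3
      refine (pow_le_pow_iff_left₀ (abs_nonneg _) (by positivity) two_ne_zero).1 ?_
      have : K * m ≤ K * t ^ 4 := by gcongr
      nlinarith [mul_nonneg (mul_nonneg hK.le hK.le) (pow_nonneg (show 0 ≤ t by linarith) 4), mul_nonneg (hK.le) (pow_nonneg (show 0 ≤ t by linarith) 4), pow_nonneg (show 0 ≤ t by linarith) 4]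
    · nlinarith

open Polynomial in
lemma small_poly_nonneg (P : ℝ[X]) (h : ∀ j : ℤ, 0 ≤ P.eval (j:ℝ)) : SmallSet {m : ℤ | ∃ j : ℤ, P.eval (j:ℝ) = m} := by
  have he := even_natDegree P h
  rcases Nat.lt_or_ge P.natDegree 2 with hlt | hge
  · have h0 : P.natDegree = 0 := by rcases he with ⟨k, hk⟩; omega
    rw [eq_C_of_natDegree_eq_zero h0]
    refine ⟨1, one_pos, fun t ht => ?_⟩
    have h2 : 1 ≤ t ^ 3 := one_le_pow₀ ht
    rw [one_mul]
    refine le_trans ?_ h2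
    have := ncard_cover {m ∈ {m : ℤ | ∃ j : ℤ, (C (P.coeff 0)).eval (j:ℝ) = m} | 1 ≤ m ∧ (m:ℝ) ≤ t ^ 4} 
      {0} (fun _ => {0}) (fun x _ => P.coeff 0) 1 1 ?_ (by simp) (by simp) zero_le_one
    · simpa using this
    · rintro m ⟨⟨j, hj⟩, _⟩
      exact ⟨0, by simp, 0, by simp, by simpa using hj⟩
  · exact small_poly P hge

end

section

lemma affine_good (l k d : ℤ) (hl : 0 < l) (hd : 0 < d) :
    GoodSet {m : ℤ | ∃ u v : ℤ, l * m + k = u ^ 2 + d * v ^ 2} := by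
  classical
  obtain ⟨C, hC, hb⟩ := landau_upper d.toNat (by omega)
  set L : ℕ := (l + |k|).toNat with hL
  have hLz : (L : ℤ) = l + |k| := by rw [hL, Int.toNat_of_nonneg]; positivity
  have hL1 : 1 ≤ L := by have := abs_nonneg k; omega
  refine ⟨C * L + 1, by positivity, fun N hN => ?_⟩
  have h1 := hb (L * N) (Nat.mul_pos hL1 hN)
  set T := (Finset.Ioc 0 (L * N)).filter (fun n : ℕ => ∃ u v : ℤ, (n:ℤ) = u ^ 2 + (d.toNat:ℕ) * v ^ 2) with hT
  have hdn : ((d.toNat : ℕ) : ℤ) = d := Int.toNat_of_nonneg hd.le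
  have hcard : {m ∈ {m : ℤ | ∃ u v : ℤ, l * m + k = u ^ 2 + d * v ^ 2} | 1 ≤ m ∧ m ≤ (N:ℤ)}.ncard ≤ (insert 0 T).card := by
    rw [← Set.ncard_coe_finset]
    refine Set.ncard_le_ncard_of_injOn (fun m => (l * m + k).toNat) ?_ ?_ (Finset.finite_toSet _)
    · rintro m ⟨⟨u, v, huv⟩, hm1, hm2⟩
      have hnn : 0 ≤ l * m + k := by rw [huv]; positivity
      rcases hnn.eq_or_lt with h0 | h0
      · simp [← h0]
      · simp only [Finset.coe_insert, Set.mem_insert_iff, Finset.mem_coe]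
        right
        rw [hT, Finset.mem_filter, Finset.mem_Ioc]
        refine ⟨⟨by omega, ?_⟩, u, v, ?_⟩
        · zify
          rw [Int.toNat_of_nonneg hnn, hLz]
          have : k ≤ |k| := le_abs_self k
          have hN' : (1:ℤ) ≤ N := by exact_mod_cast hN
          nlinarith [abs_nonneg k]
        · rw [Int.toNat_of_nonneg hnn, hdn, huv]
    · rintro m ⟨⟨u, v, huv⟩, hm1, hm2⟩ m' ⟨⟨u', v', huv'⟩, hm1', hm2'⟩ h
      have hnn : 0 ≤ l * m + k := by rw [huv]; positivity
      have hnn' : 0 ≤ l * m' + k := by rw [huv']; positivity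
      simp only at h
      have h2 : l * m + k = l * m' + k := by omega
      exact mul_left_cancel₀ hl.ne' (by linarith)
  have hcard2 : (({m ∈ {m : ℤ | ∃ u v : ℤ, l * m + k = u ^ 2 + d * v ^ 2} | 1 ≤ m ∧ m ≤ (N:ℤ)}.ncard : ℕ) : ℝ) ≤ T.card + 1 := by
    have := hcard.trans (Finset.card_insert_le _ _)
    exact_mod_cast this
  refine hcard2.trans ?_
  have hNR : (1:ℝ) ≤ N := by exact_mod_cast hN
  have hLR : (1:ℝ) ≤ L := by exact_mod_cast hL1
  have hlog0 : 0 ≤ Real.log N := Real.log_natCast_nonneg N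
  have hs0 : 0 < Real.sqrt (1 + Real.log N) := Real.sqrt_pos.2 (by linarith)
  have hone : 1 ≤ (N:ℝ) / Real.sqrt (1 + Real.log N) := by
    rw [le_div_iff₀ hs0, one_mul, Real.sqrt_le_left (by linarith)]
    have := Real.log_le_sub_one_of_pos (show (0:ℝ) < N by linarith)
    nlinarith
  have hT2 : (T.card : ℝ) ≤ C * (L * (N / Real.sqrt (1 + Real.log N))) := by
    refine h1.trans ?_
    calc C * (((L * N : ℕ) : ℝ) / Real.sqrt (1 + Real.log ((L * N : ℕ) : ℝ))) 
        ≤ C * (((L * N : ℕ) : ℝ) / Real.sqrt (1 + Real.log N)) := by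
          gcongr
          push_cast
          nlinarith
      _ = _ := by push_cast; ring
  rw [add_mul, one_mul]
  linarith

lemma rat_clear (q : ℚ) (z : ℕ) (h : q.den ∣ z) : ∃ n : ℤ, (n:ℝ) = z * (q:ℝ) := by
  obtain ⟨c, rfl⟩ := h
  refine ⟨q.num * c, ?_⟩
  have h1 : (q:ℝ) * q.den = q.num := by exact_mod_cast Rat.mul_den_eq_num q
  push_cast
  rw [← h1]; ring

lemma quadform_good (l k p q : ℚ) (hl : 0 < l) (hp : 0 < p) (hq : 0 < q) :
    GoodSet {m : ℤ | ∃ u v : ℤ, (l:ℝ) * m + k = p * (u:ℝ) ^ 2 + q * (v:ℝ) ^ 2} := by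
  set z : ℕ := l.den * k.den * p.den * q.den with hz
  have hz0 : 0 < z := by have := l.den_pos; have := k.den_pos; have := p.den_pos; have := q.den_pos; positivity
  obtain ⟨l', hl'⟩ := rat_clear l z ⟨k.den * p.den * q.den, by rw [hz]; ring⟩
  obtain ⟨k', hk'⟩ := rat_clear k z ⟨l.den * p.den * q.den, by rw [hz]; ring⟩
  obtain ⟨p', hp'⟩ := rat_clear p z ⟨l.den * k.den * q.den, by rw [hz]; ring⟩
  obtain ⟨q', hq'⟩ := rat_clear q z ⟨l.den * k.den * p.den, by rw [hz]; ring⟩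
  have hzR : (0:ℝ) < z := by exact_mod_cast hz0
  have hlR : (0:ℝ) < l := by exact_mod_cast hl
  have hpR : (0:ℝ) < p := by exact_mod_cast hp
  have hqR : (0:ℝ) < q := by exact_mod_cast hq
  have l0 : 0 < l' := by have : (0:ℝ) < l' := by rw [hl']; positivity
                         exact_mod_cast this
  have p0 : 0 < p' := by have : (0:ℝ) < p' := by rw [hp']; positivity
                         exact_mod_cast this
  have q0 : 0 < q' := by have : (0:ℝ) < q' := by rw [hq']; positivity
                         exact_mod_cast this
  refine (affine_good (p' * l') (p' * k') (p' * q') (by positivity) (by positivity)).mono ?_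
  rintro m ⟨u, v, h⟩
  refine ⟨p' * u, v, ?_⟩
  have : ((p' * l' * m + p' * k' : ℤ) : ℝ) = (((p' * u) ^ 2 + p' * q' * v ^ 2 : ℤ) : ℝ) := by
    push_cast
    rw [hl', hk', hp', hq']
    linear_combination ((z:ℝ) * p * z) * h
  exact_mod_cast this

open Polynomial in
lemma poly_clear (P : ℚ[X]) : ∃ z : ℕ, 0 < z ∧ ∀ x : ℤ, ∃ n : ℤ, (n:ℝ) = z * (P.map (algebraMap ℚ ℝ)).eval (x:ℝ) := by
  classical
  refine ⟨∏ i ∈ P.support, (P.coeff i).den, Finset.prod_pos fun i _ => (P.coeff i).den_pos, fun x => ?_⟩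
  have h : ∀ i ∈ P.support, ∃ n : ℤ, (n:ℝ) = (∏ i ∈ P.support, (P.coeff i).den : ℕ) * ((P.coeff i : ℚ) : ℝ) := 
    fun i hi => rat_clear _ _ (Finset.dvd_prod_of_mem _ hi)
  choose! f hf using h
  refine ⟨∑ i ∈ P.support, f i * x ^ i, ?_⟩
  rw [Polynomial.eval_map, Polynomial.eval₂_eq_sum, Polynomial.sum, Finset.mul_sum]
  push_cast
  refine Finset.sum_congr rfl fun i hi => ?_
  rw [hf i hi]
  push_cast
  simp [mul_assoc]

/-- real evaluation of a rational polynomial -/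
noncomputable def rev (P : Polynomial ℚ) (x : ℝ) : ℝ := (P.map (algebraMap ℚ ℝ)).eval x

/-- the nearest integer to a vertex -/
lemma vertex (A B : ℝ) (hA : 0 < A) : ∃ y : ℤ, (2 * A * y + B) ^ 2 ≤ A ^ 2 := by
  refine ⟨round (-B / (2 * A)), ?_⟩
  have h := abs_sub_round (-B / (2 * A))
  have e : 2 * A * (round (-B / (2 * A)) : ℝ) + B = -(2 * A) * (-B / (2 * A) - round (-B / (2 * A))) := by
    field_simp; ring
  rw [e, mul_pow, ← sq_abs (-B / (2 * A) - _)]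
  have h0 := abs_nonneg (-B / (2 * A) - (round (-B / (2 * A)) : ℝ))
  nlinarith [mul_pos hA hA, mul_nonneg (sub_nonneg.2 h) h0]

lemma vertex_bound (A B C : ℝ) (hA : 0 < A) (h : ∀ y : ℤ, 0 ≤ A * (y:ℝ)^2 + B * y + C) : - A ^ 2 ≤ 4 * A * C - B ^ 2 := by
  obtain ⟨y, hy⟩ := vertex A B hA
  have := h y
  nlinarith

open Polynomial in
lemma caseA_const (a : ℚ) (ha : 0 < a) (B C : ℚ[X])
    (h : ∀ x y : ℤ, 0 ≤ (a:ℝ) * (y:ℝ) ^ 2 + rev B x * y + rev C x) :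
    GoodSet {m : ℤ | ∃ x y : ℤ, (a:ℝ) * (y:ℝ) ^ 2 + rev B x * y + rev C x = m} := by
  have haR : (0:ℝ) < a := by exact_mod_cast ha
  set D : ℚ[X] := Polynomial.C (4 * a) * C - B ^ 2 with hD
  have hDe : ∀ x : ℝ, rev D x = 4 * a * rev C x - rev B x ^ 2 := by
    intro x; simp [hD, rev]
  have hDlow : ∀ x : ℤ, - (a:ℝ) ^ 2 ≤ rev D x := by
    intro x; rw [hDe]; exact vertex_bound _ _ _ haR (h x)
  have hsq : ∀ (x y : ℝ), 4 * (a:ℝ) * ((a:ℝ) * (y:ℝ) ^ 2 + rev B x * y + rev C x) = (2 * a * y + rev B x) ^ 2 + rev D x := by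
    intro x y; rw [hDe]; ring
  have hE : ∀ x : ℝ, ((D + Polynomial.C (a ^ 2)).map (algebraMap ℚ ℝ)).eval x = rev D x + a ^ 2 := by
    intro x
    rw [rev, Polynomial.map_add, eval_add, Polynomial.map_C, eval_C, eq_ratCast]; push_cast; rfl
  have heven : Even D.natDegree := by
    have := even_natDegree ((D + Polynomial.C (a ^ 2)).map (algebraMap ℚ ℝ)) (by
      intro n
      have := hDlow n
      rw [hE]; linarith)
    rwa [natDegree_map, natDegree_add_C] at this
  obtain ⟨z, hz0, hz⟩ := poly_clear B
  have hzR : (0:ℝ) < z := by exact_mod_cast hz0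
  set w : ℤ := z * a.den with hw
  have hwR : (0:ℝ) < w := by rw [hw]; have := a.den_pos; push_cast; positivity
  have hintg : ∀ x y : ℤ, ∃ n : ℤ, (n:ℝ) = w * (2 * a * y + rev B x) := by
    intro x y
    obtain ⟨n, hn⟩ := hz x
    refine ⟨2 * z * a.num * y + a.den * n, ?_⟩
    have h1 : (a:ℝ) * a.den = a.num := by exact_mod_cast Rat.mul_den_eq_num a
    push_cast
    rw [hn, hw, ← h1, rev]; push_cast; ring
  have hnd : D.natDegree = 0 ∨ D.natDegree = 2 ∨ 4 ≤ D.natDegree := by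
    obtain ⟨k, hk⟩ := heven; omega
  rcases hnd with h0 | h2 | h4
  · skip
    set k := D.coeff 0 with hk
    have hDk : ∀ x, rev D x = k := by
      intro x; rw [rev, eq_C_of_natDegree_eq_zero h0]; simp [hk]
    set P : ℝ[X] := Polynomial.C (1 / (4 * a * w ^ 2) : ℝ) * X ^ 2 + Polynomial.C ((k:ℝ) / (4 * a)) with hP
    have hPd : P.natDegree = 2 := by
      rw [hP, natDegree_add_C, natDegree_C_mul_X_pow]
      positivity
    refine ((small_poly P hPd.ge).mono ?_).good
    rintro m ⟨x, y, hxy⟩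
    obtain ⟨n, hn⟩ := hintg x y
    refine ⟨n, ?_⟩
    have := hsq x y
    rw [hDk, hxy] at this
    simp only [hP, eval_add, eval_mul, eval_C, eval_pow, eval_X]
    rw [hn]
    field_simp
    linarith
  · set d := D.coeff 2 with hd
    set e := D.coeff 1 with he
    set f := D.coeff 0 with hf
    have hDk : ∀ x, rev D x = d * x ^ 2 + e * x + f := by
      intro x; rw [rev, Polynomial.eval_map, Polynomial.eval₂_eq_sum_range, h2]
      simp [Finset.sum_range_succ, hd, he, hf]; ring
    have hd0 : d ≠ 0 := by
      rw [hd, ← h2]; 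
      intro h0
      have := leadingCoeff_eq_zero.1 h0
      rw [this] at h2; simp at h2
    have hd1 : 0 < d := by
      have := lead_nonneg ((D + Polynomial.C (a ^ 2)).map (algebraMap ℚ ℝ)) (by
        intro n
        have := hDlow n
        rw [hE]; push_cast at this; linarith)
      rw [leadingCoeff, natDegree_map, natDegree_add_C, h2, coeff_map, coeff_add, coeff_C, if_neg two_ne_zero, add_zero, eq_ratCast] at this
      have : 0 ≤ d := by exact_mod_cast this
      exact lt_of_le_of_ne this hd0.symm
    have hdR : (0:ℝ) < d := by exact_mod_cast hd1
    have hint2 : ∀ x : ℤ, ∃ n : ℤ, (n:ℝ) = (w * (d.den * e.den)) * (2 * d * x + e) := by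
      intro x
      refine ⟨w * (e.den * d.num * 2 * x + d.den * e.num), ?_⟩
      have h1 : (d:ℝ) * d.den = d.num := by exact_mod_cast Rat.mul_den_eq_num d
      have h2 : (e:ℝ) * e.den = e.num := by exact_mod_cast Rat.mul_den_eq_num e
      push_cast
      rw [← h1, ← h2]; ring
    have hw0 : (0:ℚ) < w := by exact_mod_cast hwR
    have hdd : (0:ℚ) < d.den := by exact_mod_cast d.den_pos
    have hed : (0:ℚ) < e.den := by exact_mod_cast e.den_pos
    refine (quadform_good (16 * a * d) (-(4 * d * f - e ^ 2)) (4 * d / w ^ 2) (1 / (w * (d.den * e.den)) ^ 2) 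
      (by positivity) (by positivity) (by positivity)).mono ?_
    rintro m ⟨x, y, hxy⟩
    obtain ⟨n, hn⟩ := hintg x y
    obtain ⟨n', hn'⟩ := hint2 x
    refine ⟨n, n', ?_⟩
    have h1 := hsq x y
    rw [hDk, hxy] at h1
    rw [hn, hn']
    have hddR : (0:ℝ) < d.den := by exact_mod_cast d.den_pos
    have hedR : (0:ℝ) < e.den := by exact_mod_cast e.den_pos
    push_cast
    field_simp
    linear_combination 4 * d * h1
  · obtain ⟨K, hK, hg⟩ := poly_growth (D.map (algebraMap ℚ ℝ)) 4 (by rwa [natDegree_map]) (by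
      intro h0; rw [Polynomial.map_eq_zero] at h0; rw [h0] at h4; simp at h4)
    refine SmallSet.good ?_
    set M : ℝ := K + K * (4 * a + a ^ 2) + 1 with hM
    have hM1 : 1 ≤ M := by rw [hM]; have : 0 ≤ K * (4 * a + (a:ℝ) ^ 2) := by positivity
                           linarith
    set R : ℝ := (4 * a + a ^ 2 + 1) / (2 * a) with hR
    have hR0 : 0 < R := by positivity
    refine ⟨(2 * M + 1) * (2 * R + 1), by positivity, fun t ht => ?_⟩
    have ht0 : 0 < t := by linarith
    have ht4 : 1 ≤ t ^ 4 := one_le_pow₀ ht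
    have ht2 : 1 ≤ t ^ 2 := one_le_pow₀ ht
    have := ncard_cover {m ∈ {m : ℤ | ∃ x y : ℤ, (a:ℝ) * (y:ℝ) ^ 2 + rev B x * y + rev C x = m} | 1 ≤ m ∧ (m:ℝ) ≤ t ^ 4}
      (near 0 (M * t)) (fun x => near (- rev B x / (2 * a)) (R * t ^ 2)) (fun x y => (a:ℝ) * (y:ℝ) ^ 2 + rev B x * y + rev C x)
      (2 * (M * t) + 1) (2 * (R * t ^ 2) + 1) ?_ (card_near (by positivity)) (fun x _ => card_near (by positivity)) (by positivity)
    · refine this.trans ?_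
      have e1 : 2 * (M * t) + 1 ≤ (2 * M + 1) * t := by linarith
      have e2 : 2 * (R * t ^ 2) + 1 ≤ (2 * R + 1) * t ^ 2 := by linarith
      calc _ ≤ ((2 * M + 1) * t) * ((2 * R + 1) * t ^ 2) := by gcongr
        _ = _ := by ring
    · rintro m ⟨⟨x, y, hxy⟩, hm1, hm2⟩
      have h1 := hsq x y
      rw [hxy] at h1
      have hDx := hDlow x
      have hm0 : (1:ℝ) ≤ m := by exact_mod_cast hm1
      have hmt : 4 * a * (m:ℝ) ≤ 4 * a * t ^ 4 := by gcongr
      have hDabs : |rev D x| ≤ (4 * a + a ^ 2) * t ^ 4 := by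
        rw [abs_le]; constructor <;> nlinarith [sq_nonneg (2 * a * y + rev B x)]
      refine ⟨x, mem_near.2 ?_, y, mem_near.2 ?_, hxy⟩
      · rw [sub_zero]
        rcases le_total K |(x:ℝ)| with hc | hc
        · have h3 := hg x hc
          refine (pow_le_pow_iff_left₀ (abs_nonneg _) (by positivity) four_ne_zero).1 ?_
          calc |(x:ℝ)| ^ 4 ≤ K * |rev D x| := h3
            _ ≤ K * ((4 * a + a ^ 2) * t ^ 4) := by gcongr
            _ = (K * (4 * a + a ^ 2)) * t ^ 4 := by ring
            _ ≤ M * t ^ 4 := by gcongr; rw [hM]; linarith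
            _ ≤ M ^ 4 * t ^ 4 := by gcongr; exact le_self_pow₀ hM1 (by norm_num)
            _ = _ := by ring
        · have : K ≤ M := by rw [hM]; have : 0 ≤ K * (4 * a + (a:ℝ) ^ 2) := by positivity
                             linarith
          nlinarith
      · have e : (y:ℝ) - (- rev B x / (2 * a)) = (2 * a * y + rev B x) / (2 * a) := by field_simp; ring
        rw [e, abs_div, abs_of_pos (show (0:ℝ) < 2 * a by positivity), hR, div_mul_eq_mul_div]
        gcongr
        refine (pow_le_pow_iff_left₀ (abs_nonneg _) (by positivity) two_ne_zero).1 ?_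
        rw [sq_abs]
        have : (2 * a * y + rev B x) ^ 2 ≤ (4 * a + a ^ 2 ) * t ^ 4 := by nlinarith
        refine this.trans ?_
        rw [mul_pow, ← pow_mul]
        gcongr
        have : (0:ℝ) ≤ 4 * a + a ^ 2 := by positivity
        nlinarith

end

section

open Polynomial Filter in
lemma poly_ratio (P Q : ℝ[X]) (hd : P.natDegree ≤ Q.natDegree) (hQ : Q ≠ 0) :
    ∃ K : ℝ, 0 < K ∧ ∀ x : ℝ, K ≤ |x| → |P.eval x| ≤ K * |Q.eval x| := by
  have aux : ∀ P Q : ℝ[X], P.natDegree ≤ Q.natDegree → Q ≠ 0 → ∃ K : ℝ, 0 < K ∧ ∀ x : ℝ, K ≤ x → |P.eval x| ≤ K * |Q.eval x| := by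
    intro P Q hk hQ
    have hdeg : P.degree ≤ Q.degree := by
      refine Polynomial.degree_le_natDegree.trans ?_
      rw [Polynomial.degree_eq_natDegree hQ]; exact_mod_cast hk
    have hO := Polynomial.isBigO_atTop_of_degree_le P Q hdeg
    obtain ⟨c, hc0, hc⟩ := hO.exists_pos
    rw [Asymptotics.isBigOWith_iff] at hc
    obtain ⟨a, ha⟩ := eventually_atTop.1 hc
    refine ⟨max c a, lt_max_of_lt_left hc0, fun x hx => ?_⟩
    have := ha x (le_trans (le_max_right _ _) hx)
    simp only [Real.norm_eq_abs] at this
    refine this.trans ?_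
    gcongr
    exact le_max_left _ _
  obtain ⟨K1, h1, h1'⟩ := aux P Q hd hQ
  obtain ⟨K2, h2, h2'⟩ := aux (P.comp (-X)) (Q.comp (-X)) (by rw [natDegree_comp, natDegree_comp]; simpa using hd) (by
    intro h0
    apply hQ
    have := congrArg (fun q => q.comp (-X)) h0
    simpa [comp_assoc] using this)
  refine ⟨max K1 K2, lt_max_of_lt_left h1, fun x hx => ?_⟩
  rcases le_abs.1 hx with h | h
  · refine (h1' x (le_trans (le_max_left _ _) h)).trans ?_
    gcongr; exact le_max_left _ _
  · have := h2' (-x) (le_trans (le_max_right _ _) h)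
    simp only [eval_comp, eval_neg, eval_X, neg_neg] at this
    refine this.trans ?_
    gcongr; exact le_max_right _ _

open Polynomial in
lemma cubic_int (a b c d : ℝ) (h : ∀ y : ℤ, 0 ≤ a * (y:ℝ) ^ 3 + b * (y:ℝ) ^ 2 + c * y + d) : a = 0 := by
  by_contra ha
  have := even_natDegree (C a * X ^ 3 + C b * X ^ 2 + C c * X + C d) (by intro n; simpa using h n)
  rw [natDegree_cubic ha] at this
  revert this; decide

open Polynomial in
lemma quad_int (b c d : ℝ) (h : ∀ y : ℤ, 0 ≤ b * (y:ℝ) ^ 2 + c * y + d) : 0 ≤ b ∧ (b = 0 → c = 0) := by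
  constructor
  · by_contra! hb
    have := lead_nonneg (C b * X ^ 2 + C c * X + C d) (by intro n; simpa using h n)
    rw [leadingCoeff_quadratic hb.ne] at this
    linarith
  · intro hb
    by_contra hc
    have := even_natDegree (C c * X + C d) (by intro n; simpa [hb] using h n)
    rw [natDegree_linear hc] at this
    revert this; decide

open Polynomial in
lemma small_line (F : ℝ → ℝ → ℝ) (hF : ∀ x0 y0 p q : ℤ, ∃ P : ℝ[X], ∀ j : ℝ, P.eval j = F (x0 + q * j) (y0 + p * j))
    (h : ∀ x y : ℤ, 0 ≤ F x y) (p q : ℤ) (hq : 0 < q) (hpq : IsCoprime p q) (W : ℝ) :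
    SmallSet {m : ℤ | ∃ x y : ℤ, |(q:ℝ) * y - p * x| ≤ W ∧ F x y = m} := by
  have h1 : ∀ w : ℤ, SmallSet {m : ℤ | ∃ x y : ℤ, q * y - p * x = w ∧ F x y = m} := by
    intro w
    by_cases hex : ∃ x0 y0 : ℤ, q * y0 - p * x0 = w
    · obtain ⟨x0, y0, h0⟩ := hex
      obtain ⟨P, hP⟩ := hF x0 y0 p q
      refine (small_poly_nonneg P (fun j => ?_)).mono ?_
      · rw [hP]
        have := h (x0 + q * j) (y0 + p * j)
        push_cast at this; exact this
      · rintro m ⟨x, y, hxy, hm⟩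
        have e : q * (y - y0) = p * (x - x0) := by linarith
        have : q ∣ x - x0 := hpq.symm.dvd_of_dvd_mul_left ⟨y - y0, by linarith⟩
        obtain ⟨j, hj⟩ := this
        refine ⟨j, ?_⟩
        rw [hj] at e
        have e2 : y - y0 = p * j := mul_left_cancel₀ hq.ne' (by linarith)
        rw [hP, ← hm]
        have hx : x = x0 + q * j := by linarith
        have hy : y = y0 + p * j := by linarith
        rw [hx, hy]; push_cast; rfl
    · refine SmallSet.empty.mono ?_
      rintro m ⟨x, y, hxy, _⟩
      exact hex ⟨x, y, hxy⟩
  refine (SmallSet.biUnion (near 0 W) _ (fun w _ => h1 w)).mono ?_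
  rintro m ⟨x, y, hxy, hm⟩
  simp only [Set.mem_iUnion]
  refine ⟨q * y - p * x, mem_near.2 ?_, x, y, rfl, hm⟩
  push_cast; simpa using hxy

set_option maxHeartbeats 1000000 in
open Polynomial in
lemma caseA_quad (a a1 a0 b3 b2 b1 b0 : ℚ) (C : ℚ[X]) (ha : 0 < a) (F : ℝ → ℝ → ℝ)
    (hF : ∀ x y : ℝ, F x y = (a * x ^ 2 + a1 * x + a0) * y ^ 2 + (b3 * x ^ 3 + b2 * x ^ 2 + b1 * x + b0) * y + rev C x)
    (h : ∀ x y : ℤ, 0 ≤ F x y) : SmallSet {m : ℤ | ∃ x y : ℤ, F x y = m} := by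
  have haR : (0:ℝ) < a := by exact_mod_cast ha
  set A : ℝ → ℝ := fun x => a * x ^ 2 + a1 * x + a0 with hA
  set B : ℝ → ℝ := fun x => b3 * x ^ 3 + b2 * x ^ 2 + b1 * x + b0 with hB
  have hF' : ∀ x y : ℝ, F x y = A x * y ^ 2 + B x * y + rev C x := hF
  have hq : ∀ x : ℤ, 0 ≤ A x ∧ (A x = 0 → B x = 0) := by
    intro x
    exact quad_int _ _ (rev C x) (fun y => by rw [← hF']; exact h x y)
  set AP : ℝ[X] := Polynomial.C (a:ℝ) * X ^ 2 + Polynomial.C (a1:ℝ) * X + Polynomial.C (a0:ℝ) with hAP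
  have hAPe : ∀ x, AP.eval x = A x := by intro x; simp [hAP, hA]
  have hAPd : AP.natDegree = 2 := natDegree_quadratic haR.ne'
  have hAP0 : AP ≠ 0 := by intro h0; rw [h0] at hAPd; simp at hAPd
  obtain ⟨z, hz0, hz⟩ := poly_clear (Polynomial.C a * X ^ 2 + Polynomial.C a1 * X + Polynomial.C a0)
  have hzR : (1:ℝ) ≤ z := by exact_mod_cast hz0
  have hAlow : ∀ x : ℤ, 0 < A x → 1 ≤ z * A x := by
    intro x hx
    obtain ⟨n, hn⟩ := hz x
    have e : eval (x:ℝ) (map (algebraMap ℚ ℝ) (Polynomial.C a * X ^ 2 + Polynomial.C a1 * X + Polynomial.C a0)) = A x := by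
      simp [hA]
    rw [e] at hn
    rw [← hn]
    have : (0:ℝ) < n := by rw [hn]; positivity
    have : 0 < n := by exact_mod_cast this
    exact_mod_cast this
  obtain ⟨K1, hK1, hg1⟩ := poly_growth AP 2 hAPd.ge hAP0
  set r : ℚ := - b3 / (2 * a) with hr
  set NP : ℝ[X] := Polynomial.C ((b2:ℝ) + 2 * r * a1) * X ^ 2 + Polynomial.C ((b1:ℝ) + 2 * r * a0) * X + Polynomial.C (b0:ℝ) with hNP
  have hNPe : ∀ x, NP.eval x = B x + 2 * r * x * A x := by
    intro x; simp only [hNP, hB, hA, hr, eval_add, eval_mul, eval_C, eval_pow, eval_X]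
    push_cast
    field_simp
    ring
  obtain ⟨K2, hK2, hg2⟩ := poly_ratio NP AP (by rw [hAPd]; exact natDegree_quadratic_le) hAP0
  set K : ℝ := K1 + K2 + 1 with hK
  have hKp : 1 ≤ K := by linarith
  have hest : ∀ (t : ℝ), 1 ≤ t → ∀ x y : ℤ, 0 < A x → F x y ≤ t ^ 4 → ((y:ℝ) - (- B x / (2 * A x))) ^ 2 ≤ t ^ 4 / A x + 1 / 4 := by
    intro t ht x y hAx hm
    have h1 := vertex_bound (A x) (B x) (rev C x) hAx (fun y => by rw [← hF']; exact h x y)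
    have e : ((y:ℝ) - (- B x / (2 * A x))) ^ 2 = (4 * A x * F x y - (4 * A x * rev C x - B x ^ 2)) / (4 * A x ^ 2) := by
      rw [hF']; field_simp; ring
    rw [e, div_le_iff₀ (by positivity)]
    have e2 : (t ^ 4 / A x + 1 / 4) * (4 * A x ^ 2) = 4 * A x * t ^ 4 + A x ^ 2 := by field_simp
    rw [e2]
    nlinarith
  have hpq : IsCoprime r.num (r.den : ℤ) := by
    have := r.reduced
    rw [Int.isCoprime_iff_gcd_eq_one]; simpa [Int.gcd] using this
  have hdenR : (0:ℝ) < r.den := by exact_mod_cast r.den_pos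
  have hV3 := small_line F (fun x0 y0 p q => ⟨(AP.comp (Polynomial.C (x0:ℝ) + Polynomial.C (q:ℝ) * X)) * (Polynomial.C (y0:ℝ) + Polynomial.C (p:ℝ) * X) ^ 2
      + ((Polynomial.C (b3:ℝ) * X ^ 3 + Polynomial.C (b2:ℝ) * X ^ 2 + Polynomial.C (b1:ℝ) * X + Polynomial.C (b0:ℝ)).comp (Polynomial.C (x0:ℝ) + Polynomial.C (q:ℝ) * X)) * (Polynomial.C (y0:ℝ) + Polynomial.C (p:ℝ) * X)
      + (C.map (algebraMap ℚ ℝ)).comp (Polynomial.C (x0:ℝ) + Polynomial.C (q:ℝ) * X), by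
      intro j
      rw [hF, eval_add, eval_comp (p := map _ _), rev]
      simp [hAP]⟩) h r.num r.den (by exact_mod_cast r.den_pos) hpq (r.den * (2 + K2))
  obtain ⟨C3, hC3, hb3⟩ := hV3
  refine ⟨C3 + (2 * K + 1) * (2 * (z + 1) + 1) + (2 * K + 1) * 5, by positivity, fun t ht => ?_⟩
  have ht0 : 0 < t := by linarith
  have ht4 : 1 ≤ t ^ 4 := one_le_pow₀ ht
  have ht2 : 1 ≤ t ^ 2 := one_le_pow₀ ht
  have htt : t ≤ t ^ 2 := le_self_pow₀ ht (by norm_num)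
  have h3 := hb3 t ht
  set S3 := {m ∈ {m : ℤ | ∃ x y : ℤ, |(((r.den:ℕ):ℤ):ℝ) * y - r.num * x| ≤ r.den * (2 + K2) ∧ F x y = m} | 1 ≤ m ∧ (m:ℝ) ≤ t ^ 4} with hS3
  set S1 := {m : ℤ | ∃ x y : ℤ, |(x:ℝ)| ≤ K * t ∧ F x y = m ∧ 1 ≤ m ∧ (m:ℝ) ≤ t ^ 4} with hS1
  set S2 := {m : ℤ | ∃ x y : ℤ, K * t ≤ |(x:ℝ)| ∧ |(x:ℝ)| ≤ K * t ^ 2 ∧ F x y = m ∧ 1 ≤ m ∧ (m:ℝ) ≤ t ^ 4} with hS2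
  have c1 : (S1.ncard : ℝ) ≤ (2 * (K * t) + 1) * (2 * ((z + 1) * t ^ 2) + 1) := by
    refine ncard_cover S1 (near 0 (K * t)) (fun x => near (- B x / (2 * A x)) ((z + 1) * t ^ 2)) (fun x y => F x y) _ _ ?_
      (card_near (by positivity)) (fun x _ => card_near (by positivity)) (by positivity)
    rintro m ⟨x, y, hx, hm, hm1, hm2⟩
    refine ⟨x, mem_near.2 (by simpa using hx), ?_⟩
    obtain ⟨hA0, hB0⟩ := hq x
    rcases hA0.eq_or_lt with hz' | hpos
    · refine ⟨0, mem_near.2 ?_, ?_⟩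
      · rw [← hz']; simp; positivity
      · rw [← hm, hF', hF', ← hz', hB0 hz'.symm]; ring
    · refine ⟨y, mem_near.2 ?_, hm⟩
      have := hest t ht x y hpos (by rw [hm]; exact hm2)
      refine (pow_le_pow_iff_left₀ (abs_nonneg _) (by positivity) two_ne_zero).1 ?_
      rw [sq_abs]
      refine this.trans ?_
      have h4 : t ^ 4 / A x ≤ z * t ^ 4 := by
        rw [div_le_iff₀ hpos]
        have := hAlow x hpos
        nlinarith
      have e : ((z + 1) * t ^ 2) ^ 2 = ((z:ℝ) + 1) ^ 2 * t ^ 4 := by ring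
      rw [e]
      nlinarith
  have hbig : ∀ x : ℤ, K ≤ |(x:ℝ)| → 0 < A x ∧ |(x:ℝ)| ^ 2 ≤ K1 * A x := by
    intro x hx
    have h1 := hg1 x (by linarith)
    rw [hAPe, abs_of_nonneg (hq x).1] at h1
    refine ⟨?_, h1⟩
    have : 0 < |(x:ℝ)| ^ 2 := by have : 0 < |(x:ℝ)| := by linarith
                                 positivity
    by_contra hneg
    have : A x = 0 := le_antisymm (not_lt.1 hneg) (hq x).1
    rw [this] at h1; linarith
  have c2 : (S2.ncard : ℝ) ≤ (2 * (K * t ^ 2) + 1) * (2 * (2 * t) + 1) := by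
    refine ncard_cover S2 (near 0 (K * t ^ 2)) (fun x => near (- B x / (2 * A x)) (2 * t)) (fun x y => F x y) _ _ ?_
      (card_near (by positivity)) (fun x _ => card_near (by positivity)) (by positivity)
    rintro m ⟨x, y, hx0, hx, hm, hm1, hm2⟩
    refine ⟨x, mem_near.2 (by simpa using hx), y, mem_near.2 ?_, hm⟩
    obtain ⟨hpos, hgr⟩ := hbig x (le_trans (le_mul_of_one_le_right (by linarith) ht) hx0)
    have := hest t ht x y hpos (by rw [hm]; exact hm2)
    refine (pow_le_pow_iff_left₀ (abs_nonneg _) (by positivity) two_ne_zero).1 ?_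
    rw [sq_abs]
    refine this.trans ?_
    have h4 : t ^ 4 / A x ≤ t ^ 2 := by
      rw [div_le_iff₀ hpos]
      have h5 : (K * t) ^ 2 ≤ K1 * A x := le_trans (by gcongr) hgr
      have h6 : K1 ≤ K := by linarith
      have h7 : K * t ^ 2 ≤ A x := by
        have : K * (K * t ^ 2) ≤ K * A x := by
          calc K * (K * t ^ 2) = (K * t) ^ 2 := by ring
            _ ≤ K1 * A x := h5
            _ ≤ K * A x := by gcongr
        exact le_of_mul_le_mul_left this (by linarith)
      have h8 : t ^ 2 ≤ A x := le_trans (le_mul_of_one_le_left (by positivity) hKp) h7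
      calc t ^ 4 = t ^ 2 * t ^ 2 := by ring
        _ ≤ t ^ 2 * A x := by gcongr
    nlinarith
  have hsub : {m ∈ {m : ℤ | ∃ x y : ℤ, F x y = m} | 1 ≤ m ∧ (m:ℝ) ≤ t ^ 4} ⊆ (S1 ∪ S2) ∪ S3 := by
    rintro m ⟨⟨x, y, hm⟩, hm1, hm2⟩
    rcases le_total |(x:ℝ)| (K * t) with h1 | h1
    · exact Or.inl (Or.inl ⟨x, y, h1, hm, hm1, hm2⟩)
    rcases le_total |(x:ℝ)| (K * t ^ 2) with h2 | h2
    · exact Or.inl (Or.inr ⟨x, y, h1, h2, hm, hm1, hm2⟩)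
    refine Or.inr ⟨⟨x, y, ?_, hm⟩, hm1, hm2⟩
    obtain ⟨hpos, hgr⟩ := hbig x (le_trans (le_mul_of_one_le_right (by linarith) ht2) h2)
    have h3 := hest t ht x y hpos (by rw [hm]; exact hm2)
    have h4 : t ^ 4 / A x ≤ 1 := by
      rw [div_le_one hpos]
      have h5 : (K * t ^ 2) ^ 2 ≤ K1 * A x := le_trans (by gcongr) hgr
      have h6 : K1 ≤ K := by linarith
      have h7 : K * t ^ 4 ≤ A x := by
        have : K * (K * t ^ 4) ≤ K * A x := by
          calc K * (K * t ^ 4) = (K * t ^ 2) ^ 2 := by ring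
            _ ≤ K1 * A x := h5
            _ ≤ K * A x := by gcongr
        exact le_of_mul_le_mul_left this (by linarith)
      exact le_trans (le_mul_of_one_le_left (by positivity) hKp) h7
    have h5 : |(y:ℝ) - (- B x / (2 * A x))| ≤ 2 := by
      refine (pow_le_pow_iff_left₀ (abs_nonneg _) (by positivity) two_ne_zero).1 ?_
      rw [sq_abs]; linarith
    have h6 := hg2 x (le_trans (by linarith : K2 ≤ K) (le_trans (le_mul_of_one_le_right (by linarith) ht2) h2))
    rw [hNPe, hAPe, abs_of_pos hpos] at h6
    have h7 : |(B x + 2 * r * x * A x) / (2 * A x)| ≤ K2 := by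
      rw [abs_div, abs_of_pos (show 0 < 2 * A x by linarith), div_le_iff₀ (by linarith)]
      nlinarith
    have hnum : (r:ℝ) * r.den = r.num := by exact_mod_cast Rat.mul_den_eq_num r
    have e : (((r.den:ℕ):ℤ):ℝ) * y - r.num * x = r.den * (((y:ℝ) - (- B x / (2 * A x))) - (B x + 2 * r * x * A x) / (2 * A x)) := by
      rw [← hnum]; push_cast; field_simp; ring
    rw [e, abs_mul, abs_of_pos hdenR]
    gcongr
    exact (abs_sub _ _).trans (add_le_add h5 h7)
  have f1 : S1.Finite := (Set.finite_Icc (1:ℤ) ⌊t ^ 4⌋).subset (by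
    rintro m ⟨x, y, _, _, h1, h2⟩; exact ⟨h1, Int.le_floor.2 h2⟩)
  have f2 : S2.Finite := (Set.finite_Icc (1:ℤ) ⌊t ^ 4⌋).subset (by
    rintro m ⟨x, y, _, _, _, h1, h2⟩; exact ⟨h1, Int.le_floor.2 h2⟩)
  have f3 : S3.Finite := slice_finite _ _
  have hc : (({m ∈ {m : ℤ | ∃ x y : ℤ, F x y = m} | 1 ≤ m ∧ (m:ℝ) ≤ t ^ 4}).ncard : ℝ) ≤ S1.ncard + S2.ncard + S3.ncard := by
    have h1 := Set.ncard_le_ncard hsub ((f1.union f2).union f3)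
    have h2 := Set.ncard_union_le (S1 ∪ S2) S3
    have h3 := Set.ncard_union_le S1 S2
    have : ({m ∈ {m : ℤ | ∃ x y : ℤ, F x y = m} | 1 ≤ m ∧ (m:ℝ) ≤ t ^ 4}).ncard ≤ S1.ncard + S2.ncard + S3.ncard := by omega
    exact_mod_cast this
  have d1 : (2 * (K * t) + 1) * (2 * ((z + 1) * t ^ 2) + 1) ≤ (2 * K + 1) * (2 * (z + 1) + 1) * t ^ 3 := by
    calc _ ≤ ((2 * K + 1) * t) * ((2 * (z + 1) + 1) * t ^ 2) := by gcongr <;> linarith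
      _ = _ := by ring
  have d2 : (2 * (K * t ^ 2) + 1) * (2 * (2 * t) + 1) ≤ (2 * K + 1) * 5 * t ^ 3 := by
    calc _ ≤ ((2 * K + 1) * t ^ 2) * (5 * t) := by gcongr <;> linarith
      _ = _ := by ring
  linarith

end

section

/-- coefficients of a polynomial of degree at most four in two variables -/
structure Q4 where
  (a00 a10 a01 a20 a11 a02 a30 a21 a12 a03 a40 a31 a22 a13 a04 : ℚ)

/-- real evaluation -/
noncomputable def Q4.ev (F : Q4) (x y : ℝ) : ℝ :=
  F.a00 + F.a10 * x + F.a01 * y + F.a20 * x ^ 2 + F.a11 * x * y + F.a02 * y ^ 2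
  + F.a30 * x ^ 3 + F.a21 * x ^ 2 * y + F.a12 * x * y ^ 2 + F.a03 * y ^ 3
  + F.a40 * x ^ 4 + F.a31 * x ^ 3 * y + F.a22 * x ^ 2 * y ^ 2 + F.a13 * x * y ^ 3 + F.a04 * y ^ 4

/-- integer values at integer points -/
def Q4.vals (F : Q4) : Set ℤ := {m : ℤ | ∃ x y : ℤ, F.ev x y = m}

/-- nonnegativity at integer points -/
def Q4.NN (F : Q4) : Prop := ∀ x y : ℤ, 0 ≤ F.ev x y

/-- linear substitution -/
def Q4.subst (F : Q4) (p q r s : ℚ) : Q4 where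
  a00 := F.a00
  a10 := F.a01*s + F.a10*r
  a01 := F.a01*p + F.a10*q
  a20 := F.a02*s^2 + F.a11*r*s + F.a20*r^2
  a11 := 2*F.a02*s*p + F.a11*q*s + F.a11*r*p + 2*F.a20*r*q
  a02 := F.a02*p^2 + F.a11*q*p + F.a20*q^2
  a30 := F.a03*s^3 + F.a12*r*s^2 + F.a21*r^2*s + F.a30*r^3
  a21 := 3*F.a03*s^2*p + F.a12*q*s^2 + 2*F.a12*r*s*p + 2*F.a21*r*q*s + F.a21*r^2*p + 3*F.a30*r^2*q
  a12 := 3*F.a03*s*p^2 + 2*F.a12*q*s*p + F.a12*r*p^2 + F.a21*q^2*s + 2*F.a21*r*q*p + 3*F.a30*r*q^2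
  a03 := F.a03*p^3 + F.a12*q*p^2 + F.a21*q^2*p + F.a30*q^3
  a40 := F.a04*s^4 + F.a13*r*s^3 + F.a22*r^2*s^2 + F.a31*r^3*s + F.a40*r^4
  a31 := 4*F.a04*s^3*p + F.a13*q*s^3 + 3*F.a13*r*s^2*p + 2*F.a22*r*q*s^2 + 2*F.a22*r^2*s*p + 3*F.a31*r^2*q*s + F.a31*r^3*p + 4*F.a40*r^3*q
  a22 := 6*F.a04*s^2*p^2 + 3*F.a13*q*s^2*p + 3*F.a13*r*s*p^2 + F.a22*q^2*s^2 + 4*F.a22*r*q*s*p + F.a22*r^2*p^2 + 3*F.a31*r*q^2*s + 3*F.a31*r^2*q*p + 6*F.a40*r^2*q^2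
  a13 := 4*F.a04*s*p^3 + 3*F.a13*q*s*p^2 + F.a13*r*p^3 + 2*F.a22*q^2*s*p + 2*F.a22*r*q*p^2 + F.a31*q^3*s + 3*F.a31*r*q^2*p + 4*F.a40*r*q^3
  a04 := F.a04*p^4 + F.a13*q*p^3 + F.a22*q^2*p^2 + F.a31*q^3*p + F.a40*q^4

lemma Q4.subst_ev (F : Q4) (p q r s : ℚ) (x y : ℝ) :
    (F.subst p q r s).ev x y = F.ev (r * x + q * y) (s * x + p * y) := by
  simp only [Q4.ev, Q4.subst]
  push_cast
  ring

open Polynomial in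
lemma caseI0 (F : Q4) (hF : F.NN) (h04 : F.a04 = 0) : GoodSet F.vals := by
  have h3 : ∀ x : ℤ, (F.a13 : ℝ) * x + F.a03 = 0 := by
    intro x
    refine cubic_int _ ((F.a22 : ℝ) * x ^ 2 + F.a12 * x + F.a02) (F.a31 * x ^ 3 + F.a21 * x ^ 2 + F.a11 * x + F.a01)
      (F.a40 * x ^ 4 + F.a30 * x ^ 3 + F.a20 * x ^ 2 + F.a10 * x + F.a00) (fun y => ?_)
    have := hF x y
    rw [Q4.ev, h04] at this
    push_cast at this
    linarith
  have h03 : (F.a03 : ℝ) = 0 := by simpa using h3 0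
  have h13 : (F.a13 : ℝ) = 0 := by simpa [h03] using h3 1
  set Cp : ℚ[X] := C F.a40 * X ^ 4 + C F.a30 * X ^ 3 + C F.a20 * X ^ 2 + C F.a10 * X + C F.a00 with hCp
  have hC : ∀ x, rev Cp x = F.a40 * x ^ 4 + F.a30 * x ^ 3 + F.a20 * x ^ 2 + F.a10 * x + F.a00 := by
    intro x; simp [rev, hCp]
  have hev : ∀ x y : ℝ, F.ev x y = (F.a22 * x ^ 2 + F.a12 * x + F.a02) * y ^ 2
      + (F.a31 * x ^ 3 + F.a21 * x ^ 2 + F.a11 * x + F.a01) * y + rev Cp x := by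
    intro x y
    rw [hC, Q4.ev, h04, h03, h13]; push_cast; ring
  have hq : ∀ x : ℤ, 0 ≤ (F.a22 * x ^ 2 + F.a12 * x + F.a02 : ℝ) ∧ ((F.a22 * x ^ 2 + F.a12 * x + F.a02 : ℝ) = 0 → (F.a31 * x ^ 3 + F.a21 * x ^ 2 + F.a11 * x + F.a01 : ℝ) = 0) := by
    intro x
    exact quad_int _ _ (rev Cp x) (fun y => by rw [← hev]; exact hF x y)
  obtain ⟨h22, h22'⟩ := quad_int F.a22 F.a12 F.a02 (fun x => (hq x).1)
  rcases h22.eq_or_lt with h0 | hpos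
  · have h12 := h22' h0.symm
    have h02 : 0 ≤ (F.a02 : ℝ) := by simpa using (hq 0).1
    rcases h02.eq_or_lt with h00 | hpos
    · refine ((small_poly_nonneg (Cp.map (algebraMap ℚ ℝ)) ?_).mono ?_).good
      · intro j
        have := hF j 0
        rw [hev] at this
        simpa [rev] using this
      · rintro m ⟨x, y, hm⟩
        refine ⟨x, ?_⟩
        have e := (hq x).2 (by rw [← h0, h12, ← h00]; ring)
        rw [hev, e, ← h0, h12, ← h00] at hm
        rw [← hm, rev]; ring
    · set Bp : ℚ[X] := C F.a31 * X ^ 3 + C F.a21 * X ^ 2 + C F.a11 * X + C F.a01 with hBp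
      have hB : ∀ x, rev Bp x = F.a31 * x ^ 3 + F.a21 * x ^ 2 + F.a11 * x + F.a01 := by
        intro x; simp [rev, hBp]
      have hev2 : ∀ x y : ℝ, F.ev x y = F.a02 * y ^ 2 + rev Bp x * y + rev Cp x := by
        intro x y; rw [hev, hB, ← h0, h12]; ring
      have := caseA_const F.a02 (by exact_mod_cast hpos) Bp Cp (fun x y => by rw [← hev2]; exact hF x y)
      refine this.mono ?_
      rintro m ⟨x, y, hm⟩
      exact ⟨x, y, by rw [← hev2]; exact hm⟩
  · exact (caseA_quad F.a22 F.a12 F.a02 F.a31 F.a21 F.a11 F.a01 Cp (by exact_mod_cast hpos) F.ev hev hF).good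

lemma caseI (F : Q4) (hF : F.NN) (ρ : ℚ) (h : F.a40 + F.a31 * ρ + F.a22 * ρ ^ 2 + F.a13 * ρ ^ 3 + F.a04 * ρ ^ 4 = 0) :
    GoodSet F.vals := by
  have hpq : IsCoprime ρ.num (ρ.den : ℤ) := by
    have := ρ.reduced
    rw [Int.isCoprime_iff_gcd_eq_one]; simpa [Int.gcd] using this
  obtain ⟨u, v, huv⟩ := hpq
  set p := ρ.num with hp
  set q : ℤ := (ρ.den : ℤ) with hq
  have hqQ : (q:ℚ) ≠ 0 := by rw [hq]; exact_mod_cast ρ.den_ne_zero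
  have hρ : ρ = p / q := by rw [hp, hq]; exact_mod_cast (Rat.num_div_den ρ).symm
  have hsub := caseI0 (F.subst p q u (-v)) ?_ ?_
  · refine hsub.mono ?_
    rintro m ⟨x, y, hm⟩
    refine ⟨p * x - q * y, v * x + u * y, ?_⟩
    rw [Q4.subst_ev, ← hm]
    have huvR : (u:ℝ) * p + v * q = 1 := by exact_mod_cast huv
    congr 1
    · push_cast; linear_combination (x:ℝ) * huvR
    · push_cast; linear_combination (y:ℝ) * huvR
  · intro x y
    rw [Q4.subst_ev]
    have := hF (u * x + q * y) (-v * x + p * y)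
    push_cast at this ⊢
    exact this
  · simp only [Q4.subst]
    rw [hρ] at h
    field_simp at h
    linear_combination h

end

section

lemma mprod_ge (s : Multiset ℂ) (y : ℂ) (R : ℝ) (hR : 0 ≤ R) (h : ∀ z ∈ s, R ≤ ‖y - z‖) :
    R ^ (Multiset.card s) ≤ ‖(s.map (fun z => y - z)).prod‖ := by
  induction s using Multiset.induction_on with
  | empty => simp
  | cons a s ih =>
    rw [Multiset.map_cons, Multiset.prod_cons, Multiset.card_cons, norm_mul, pow_succ, mul_comm]
    have h1 := h a (Multiset.mem_cons_self a s)
    have h2 := ih (fun z hz => h z (Multiset.mem_cons_of_mem hz))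
    gcongr

open Polynomial in
lemma root_near (P : ℂ[X]) (y : ℂ) (R : ℝ) (hR : 0 ≤ R) (h : ‖P.eval y‖ < ‖P.leadingCoeff‖ * R ^ P.natDegree) :
    ∃ z ∈ P.roots, ‖y - z‖ < R := by
  by_contra! hcon
  have hs := IsAlgClosed.splits P
  have h1 := mprod_ge P.roots y R hR hcon
  rw [← hs.natDegree_eq_card_roots] at h1
  rw [hs.eval_eq_prod_roots, norm_mul] at h
  have : ‖P.leadingCoeff‖ * R ^ P.natDegree ≤ ‖P.leadingCoeff‖ * ‖(P.roots.map (fun z => y - z)).prod‖ := by gcongr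
  linarith

open Polynomial in
lemma quartic_count (b4 b3 b2 b1 b0 : ℝ) (hb : b4 ≠ 0) (t : ℝ) (ht : 1 ≤ t) : ∃ Y : Finset ℤ,
    (Y.card : ℝ) ≤ 4 * (2 * ((1 / |b4| + 2) * t) + 1) ∧ 
    ∀ y : ℤ, |b4 * (y:ℝ) ^ 4 + b3 * (y:ℝ) ^ 3 + b2 * (y:ℝ) ^ 2 + b1 * y + b0| ≤ t ^ 4 → y ∈ Y := by
  classical
  set P : ℂ[X] := C (b4:ℂ) * X ^ 4 + C (b3:ℂ) * X ^ 3 + C (b2:ℂ) * X ^ 2 + C (b1:ℂ) * X + C (b0:ℂ) with hP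
  have hb4 : (b4:ℂ) ≠ 0 := by exact_mod_cast hb
  have hc4 : P.coeff 4 = b4 := by simp [hP]
  have hle : P.natDegree ≤ 4 := by rw [hP]; compute_degree
  have hd : P.natDegree = 4 := natDegree_eq_of_le_of_coeff_ne_zero hle (by rw [hc4]; exact hb4)
  have hl : P.leadingCoeff = b4 := by rw [leadingCoeff, hd, hc4]
  set R := (1 / |b4| + 2) * t with hR
  have hb0 : 0 < |b4| := abs_pos.2 hb
  have hR0 : 0 < R := by positivity
  refine ⟨P.roots.toFinset.biUnion (fun z => near z.re R), ?_, ?_⟩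
  · refine le_trans (Nat.cast_le.2 Finset.card_biUnion_le) ?_
    push_cast
    calc _ ≤ ∑ z ∈ P.roots.toFinset, (2 * R + 1) := Finset.sum_le_sum fun z _ => card_near hR0.le
      _ = P.roots.toFinset.card * (2 * R + 1) := by rw [Finset.sum_const, nsmul_eq_mul]
      _ ≤ 4 * (2 * R + 1) := by
        gcongr
        have : P.roots.toFinset.card ≤ 4 := (Multiset.toFinset_card_le _).trans ((card_roots' P).trans hle)
        exact_mod_cast this
  · intro y hy
    have hev : P.eval (y:ℂ) = ((b4 * (y:ℝ) ^ 4 + b3 * (y:ℝ) ^ 3 + b2 * (y:ℝ) ^ 2 + b1 * y + b0 : ℝ) : ℂ) := by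
      simp [hP]
    obtain ⟨z, hz, hzy⟩ := root_near P y R hR0.le (by
      rw [hev, Complex.norm_real, Real.norm_eq_abs, hl, hd, Complex.norm_real, Real.norm_eq_abs]
      refine lt_of_le_of_lt hy ?_
      rw [hR, mul_pow, ← mul_assoc]
      have h1 : 1 < |b4| * (1 / |b4| + 2) ^ 4 := by
        have e : |b4| * (1 / |b4| + 2) = 1 + 2 * |b4| := by field_simp
        have h2 : (1:ℝ) ≤ (1 / |b4| + 2) ^ 3 := one_le_pow₀ (by have : 0 < 1 / |b4| := by positivity
                                                                linarith)
        calc 1 < 1 + 2 * |b4| := by linarith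
          _ ≤ (1 + 2 * |b4|) * (1 / |b4| + 2) ^ 3 := le_mul_of_one_le_right (by positivity) h2
          _ = _ := by rw [← e]; ring
      have h4 : 0 < t ^ 4 := by positivity
      nlinarith)
    rw [Finset.mem_biUnion]
    refine ⟨z, Multiset.mem_toFinset.2 hz, mem_near.2 ?_⟩
    have := Complex.abs_re_le_norm ((y:ℂ) - z)
    simp at this
    linarith

lemma growth_small (F : Q4) (hF : F.NN) (h04 : F.a04 ≠ 0) (K δ : ℝ) (hK : 0 < K) (hδ : 0 < δ)
    (h : ∀ x y : ℤ, K ≤ |(x:ℝ)| → δ * (x:ℝ) ^ 2 ≤ F.ev x y) : SmallSet F.vals := by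
  set M := K + 1 / δ + 1 with hM
  set c := 1 / |(F.a04:ℝ)| + 2 with hc
  have h04R : (F.a04:ℝ) ≠ 0 := by exact_mod_cast h04
  have hc0 : 0 < c := by positivity
  have hd0 : 0 < 1 / δ := by positivity
  refine ⟨(2 * M + 1) * (4 * (2 * c + 1)), by positivity, fun t ht => ?_⟩
  have ht0 : 0 < t := by linarith
  have ht2 : 1 ≤ t ^ 2 := one_le_pow₀ ht
  choose Y hY1 hY2 using fun x : ℤ => quartic_count F.a04 (F.a13 * x + F.a03) (F.a22 * x ^ 2 + F.a12 * x + F.a02) 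
    (F.a31 * x ^ 3 + F.a21 * x ^ 2 + F.a11 * x + F.a01)
    (F.a40 * x ^ 4 + F.a30 * x ^ 3 + F.a20 * x ^ 2 + F.a10 * x + F.a00) h04R t ht
  have := ncard_cover {m ∈ F.vals | 1 ≤ m ∧ (m:ℝ) ≤ t ^ 4} (near 0 (M * t ^ 2)) Y (fun x y => F.ev x y)
    (2 * (M * t ^ 2) + 1) (4 * (2 * (c * t) + 1)) ?_ (card_near (by positivity)) (fun x _ => hY1 x) (by positivity)
  · refine this.trans ?_
    calc _ ≤ ((2 * M + 1) * t ^ 2) * ((4 * (2 * c + 1)) * t) :=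
          mul_le_mul (by linarith) (by linarith) (by positivity) (by positivity)
      _ = _ := by ring
  · rintro m ⟨⟨x, y, hm⟩, hm1, hm2⟩
    refine ⟨x, mem_near.2 ?_, y, hY2 x y ?_, hm⟩
    · rw [sub_zero]
      rcases le_total K |(x:ℝ)| with hx | hx
      · have h1 := h x y hx
        rw [hm] at h1
        refine (pow_le_pow_iff_left₀ (abs_nonneg _) (by positivity) two_ne_zero).1 ?_
        rw [sq_abs]
        have h2 : (x:ℝ) ^ 2 ≤ 1 / δ * t ^ 4 := by
          rw [one_div_mul_eq_div, le_div_iff₀ hδ]; linarith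
        refine h2.trans ?_
        rw [mul_pow, ← pow_mul]
        gcongr
        nlinarith
      · refine hx.trans ?_
        have : K ≤ M := by linarith
        nlinarith
    · have e : (F.a04:ℝ) * (y:ℝ) ^ 4 + (F.a13 * x + F.a03) * (y:ℝ) ^ 3 + (F.a22 * x ^ 2 + F.a12 * x + F.a02) * (y:ℝ) ^ 2
        + (F.a31 * x ^ 3 + F.a21 * x ^ 2 + F.a11 * x + F.a01) * y + (F.a40 * x ^ 4 + F.a30 * x ^ 3 + F.a20 * x ^ 2 + F.a10 * x + F.a00) = F.ev x y := by
        rw [Q4.ev]; ring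
      rw [e, abs_of_nonneg (hF x y), hm]; exact hm2

end

section

/-- leading form at `(1,s)` -/
noncomputable def Q4.f4 (F : Q4) (s : ℝ) : ℝ := F.a40 + F.a31 * s + F.a22 * s ^ 2 + F.a13 * s ^ 3 + F.a04 * s ^ 4

open Polynomial in
lemma coeff4_nonneg (P : ℝ[X]) (hd : P.natDegree ≤ 4) (h : ∀ n : ℕ, 0 ≤ P.eval (n:ℝ)) : 0 ≤ P.coeff 4 := by
  rcases hd.eq_or_lt with he | hl
  · have := lead_nonneg P h
    rwa [leadingCoeff, he] at this
  · rw [coeff_eq_zero_of_natDegree_lt hl]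

open Polynomial in
lemma Q4.F4_nonneg (F : Q4) (hF : F.NN) (x y : ℤ) :
    0 ≤ (F.a40 * x ^ 4 + F.a31 * x ^ 3 * y + F.a22 * x ^ 2 * y ^ 2 + F.a13 * x * y ^ 3 + F.a04 * y ^ 4 : ℝ) := by
  set P : ℝ[X] := C (F.a40 * x ^ 4 + F.a31 * x ^ 3 * y + F.a22 * x ^ 2 * y ^ 2 + F.a13 * x * y ^ 3 + F.a04 * y ^ 4 : ℝ) * X ^ 4
    + C (F.a30 * x ^ 3 + F.a21 * x ^ 2 * y + F.a12 * x * y ^ 2 + F.a03 * y ^ 3 : ℝ) * X ^ 3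
    + C (F.a20 * x ^ 2 + F.a11 * x * y + F.a02 * y ^ 2 : ℝ) * X ^ 2 + C (F.a10 * x + F.a01 * y : ℝ) * X + C (F.a00 : ℝ) with hP
  have h := coeff4_nonneg P (by rw [hP]; compute_degree) (by
    intro n
    have := hF (n * x) (n * y)
    rw [Q4.ev] at this
    simp only [hP, eval_add, eval_mul, eval_C, eval_pow, eval_X]
    push_cast at this
    linarith)
  have e : P.coeff 4 = (F.a40 * x ^ 4 + F.a31 * x ^ 3 * y + F.a22 * x ^ 2 * y ^ 2 + F.a13 * x * y ^ 3 + F.a04 * y ^ 4 : ℝ) := by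
    rw [hP]
    simp only [coeff_add, coeff_C_mul, coeff_X_pow, coeff_C, coeff_X]
    norm_num
  rwa [e] at h

lemma Q4.f4_nonneg (F : Q4) (hF : F.NN) (s : ℝ) : 0 ≤ F.f4 s := by
  have hcl : IsClosed {s : ℝ | 0 ≤ F.f4 s} := by
    apply isClosed_le continuous_const
    unfold Q4.f4; fun_prop
  refine (Rat.isDenseEmbedding_coe_real.dense).induction_on (p := fun s => 0 ≤ F.f4 s) s hcl ?_
  intro r
  have h := F.F4_nonneg hF r.den r.num
  have hd : (0:ℝ) < r.den := by exact_mod_cast r.den_pos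
  have hr : (r:ℝ) * r.den = r.num := by exact_mod_cast Rat.mul_den_eq_num r
  rw [← hr] at h
  have e : F.f4 r * (r.den:ℝ) ^ 4 = (F.a40 * ((r.den:ℤ):ℝ) ^ 4 + F.a31 * ((r.den:ℤ):ℝ) ^ 3 * (r * r.den) + F.a22 * ((r.den:ℤ):ℝ) ^ 2 * (r * r.den) ^ 2 
     + F.a13 * ((r.den:ℤ):ℝ) * (r * r.den) ^ 3 + F.a04 * (r * r.den) ^ 4 : ℝ) := by
    rw [Q4.f4]; push_cast; ring
  rw [← e] at h
  exact nonneg_of_mul_nonneg_left h (by positivity)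

lemma circle_compact : IsCompact {p : ℝ × ℝ | p.1 ^ 2 + p.2 ^ 2 = 1} := by
  refine Metric.isCompact_of_isClosed_isBounded (isClosed_eq (by fun_prop) (by fun_prop)) ?_
  refine (Metric.isBounded_closedBall (x := (0 : ℝ × ℝ)) (r := 1)).subset ?_
  rintro ⟨x, y⟩ h
  have h : x ^ 2 + y ^ 2 = 1 := h
  rw [mem_closedBall_zero_iff, Prod.norm_def]
  simp only [Real.norm_eq_abs, sup_le_iff]
  constructor <;> (rw [abs_le]; constructor <;> nlinarith [sq_nonneg x, sq_nonneg y])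

lemma circle_lower (H : ℝ → ℝ → ℝ) (hc : Continuous (fun p : ℝ × ℝ => H p.1 p.2))
    (hom : ∀ l x y, H (l * x) (l * y) = l ^ 4 * H x y) (hpos : ∀ x y : ℝ, x ^ 2 + y ^ 2 = 1 → 0 < H x y) :
    ∃ δ : ℝ, 0 < δ ∧ ∀ x y, δ * (x ^ 2 + y ^ 2) ^ 2 ≤ H x y := by
  obtain ⟨p, hp, hmin⟩ := circle_compact.exists_isMinOn ⟨((1:ℝ), (0:ℝ)), by simp⟩ hc.continuousOn
  refine ⟨H p.1 p.2, hpos _ _ hp, fun x y => ?_⟩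
  set r := Real.sqrt (x ^ 2 + y ^ 2) with hr
  have hr2 : r ^ 2 = x ^ 2 + y ^ 2 := Real.sq_sqrt (by positivity)
  rcases (Real.sqrt_nonneg (x ^ 2 + y ^ 2)).eq_or_lt with h0 | h0
  · rw [← hr] at h0
    have hs : x ^ 2 + y ^ 2 = 0 := by rw [← hr2, ← h0]; ring
    have hx : x = 0 := by nlinarith [sq_nonneg x, sq_nonneg y]
    have hy : y = 0 := by nlinarith [sq_nonneg x, sq_nonneg y]
    have := hom 0 x y
    rw [hx, hy] at this
    rw [hx, hy]; simp at this ⊢; rw [this]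
  · rw [← hr] at h0
    have h1 := hmin (show (x / r, y / r) ∈ {p : ℝ × ℝ | p.1 ^ 2 + p.2 ^ 2 = 1} by
      show (x / r) ^ 2 + (y / r) ^ 2 = 1
      field_simp; rw [hr2])
    have h1 : H p.1 p.2 ≤ H (x / r) (y / r) := h1
    have h2 := hom r (x / r) (y / r)
    rw [mul_div_cancel₀ _ h0.ne', mul_div_cancel₀ _ h0.ne'] at h2
    rw [h2, ← hr2, ← pow_mul, mul_comm]
    gcongr

lemma circle_combo (q r : ℝ × ℝ → ℝ) (hq : Continuous q) (hr : Continuous r) (hq0 : ∀ p, 0 ≤ q p)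
    (h : ∀ p : ℝ × ℝ, p.1 ^ 2 + p.2 ^ 2 = 1 → q p = 0 → 0 < r p) : 
    ∃ K : ℝ, 0 < K ∧ ∀ p : ℝ × ℝ, p.1 ^ 2 + p.2 ^ 2 = 1 → 0 < K * q p + r p := by
  set S := {p : ℝ × ℝ | p.1 ^ 2 + p.2 ^ 2 = 1} with hS
  have hT : IsCompact (S ∩ {p | r p ≤ 0}) := circle_compact.inter_right (isClosed_le hr continuous_const)
  rcases (S ∩ {p | r p ≤ 0}).eq_empty_or_nonempty with he | hne
  · refine ⟨1, one_pos, fun p hp => ?_⟩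
    have : 0 < r p := by
      by_contra! hcon
      have : p ∈ S ∩ {p | r p ≤ 0} := ⟨hp, hcon⟩
      rw [he] at this; exact this
    have := hq0 p
    linarith
  · obtain ⟨p1, hp1, hm1⟩ := hT.exists_isMinOn hne hq.continuousOn
    obtain ⟨p2, hp2, hm2⟩ := hT.exists_isMinOn hne hr.continuousOn
    have hq1 : 0 < q p1 := by
      refine lt_of_le_of_ne (hq0 _) fun h0 => ?_
      have := h p1 hp1.1 h0.symm
      exact absurd hp1.2 (not_le.2 this)
    have hr2 : r p2 ≤ 0 := hp2.2
    refine ⟨(1 - r p2) / q p1, by apply div_pos <;> linarith, fun p hp => ?_⟩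
    rcases le_or_gt (r p) 0 with hle | hgt
    · have h1 : q p1 ≤ q p := hm1 (show p ∈ S ∩ {p | r p ≤ 0} from ⟨hp, hle⟩)
      have h2 : r p2 ≤ r p := hm2 (show p ∈ S ∩ {p | r p ≤ 0} from ⟨hp, hle⟩)
      have h3 : (1 - r p2) / q p1 * q p1 ≤ (1 - r p2) / q p1 * q p := by
        gcongr
        apply div_nonneg <;> linarith
      rw [div_mul_cancel₀ _ hq1.ne'] at h3
      linarith
    · have : 0 ≤ (1 - r p2) / q p1 * q p := mul_nonneg (by apply div_nonneg <;> linarith) (hq0 p)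
      linarith

lemma mono_bound (a x y r : ℝ) (i j : ℕ) (hx : |x| ≤ r) (hy : |y| ≤ r) (hr : 1 ≤ r) (n : ℕ) (hn : i + j ≤ n) :
    |a * x ^ i * y ^ j| ≤ |a| * r ^ n := by
  rw [abs_mul, abs_mul, abs_pow, abs_pow, mul_assoc]
  gcongr
  calc |x| ^ i * |y| ^ j ≤ r ^ i * r ^ j := by gcongr
    _ = r ^ (i + j) := by ring
    _ ≤ r ^ n := pow_le_pow_right₀ hr hn

lemma caseII1 (F : Q4) (hF : F.NN) (h04 : 0 < F.a04) (hpos : ∀ s, 0 < F.f4 s) : SmallSet F.vals := by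
  have h04R : (0:ℝ) < F.a04 := by exact_mod_cast h04
  obtain ⟨δ, hδ, hl⟩ := circle_lower (fun x y => F.a40 * x ^ 4 + F.a31 * x ^ 3 * y + F.a22 * x ^ 2 * y ^ 2 + F.a13 * x * y ^ 3 + F.a04 * y ^ 4 ) 
    (by fun_prop) (by intro l x y; ring) (by
      intro x y hxy
      by_cases hx : x = 0
      · subst hx
        have : y ^ 2 = 1 := by linarith
        have e : y ^ 4 = 1 := by rw [show y ^ 4 = (y ^ 2) ^ 2 by ring, this]; norm_num
        simp [e]; exact h04
      · have := hpos (y / x)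
        have e : F.a40 * x ^ 4 + F.a31 * x ^ 3 * y + F.a22 * x ^ 2 * y ^ 2 + F.a13 * x * y ^ 3 + F.a04 * y ^ 4 = x ^ 4 * F.f4 (y / x) := by
          rw [Q4.f4]; field_simp
        rw [e]; positivity)
  set M : ℝ := |(F.a00:ℝ)| + |(F.a10:ℝ)| + |(F.a01:ℝ)| + |(F.a20:ℝ)| + |(F.a11:ℝ)| + |(F.a02:ℝ)| + |(F.a30:ℝ)| + |(F.a21:ℝ)| + |(F.a12:ℝ)| + |(F.a03:ℝ)| with hM
  have hM0 : 0 ≤ M := by positivity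
  refine growth_small F hF h04.ne' ((M + 1) / δ + 1) 1 (by positivity) one_pos ?_
  intro x y hx
  set r := Real.sqrt ((x:ℝ) ^ 2 + (y:ℝ) ^ 2) with hr
  have hr2 : r ^ 2 = (x:ℝ) ^ 2 + (y:ℝ) ^ 2 := Real.sq_sqrt (by positivity)
  have hrx : |(x:ℝ)| ≤ r := Real.abs_le_sqrt (by nlinarith [sq_nonneg (y:ℝ)])
  have hry : |(y:ℝ)| ≤ r := Real.abs_le_sqrt (by nlinarith [sq_nonneg (x:ℝ)])
  have hd0 : 0 ≤ (M + 1) / δ := by positivity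
  have hr1 : 1 ≤ r := by linarith
  have hrK : (M + 1) ≤ δ * r := by
    have : (M + 1) / δ ≤ r := by linarith
    rw [div_le_iff₀ hδ] at this; linarith
  have h1 := hl x y
  rw [← hr2] at h1
  have b00 := neg_le_of_abs_le (mono_bound F.a00 x y r 0 0 hrx hry hr1 3 (by norm_num))
  have b10 := neg_le_of_abs_le (mono_bound F.a10 x y r 1 0 hrx hry hr1 3 (by norm_num))
  have b01 := neg_le_of_abs_le (mono_bound F.a01 x y r 0 1 hrx hry hr1 3 (by norm_num))
  have b20 := neg_le_of_abs_le (mono_bound F.a20 x y r 2 0 hrx hry hr1 3 (by norm_num))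
  have b11 := neg_le_of_abs_le (mono_bound F.a11 x y r 1 1 hrx hry hr1 3 (by norm_num))
  have b02 := neg_le_of_abs_le (mono_bound F.a02 x y r 0 2 hrx hry hr1 3 (by norm_num))
  have b30 := neg_le_of_abs_le (mono_bound F.a30 x y r 3 0 hrx hry hr1 3 (by norm_num))
  have b21 := neg_le_of_abs_le (mono_bound F.a21 x y r 2 1 hrx hry hr1 3 (by norm_num))
  have b12 := neg_le_of_abs_le (mono_bound F.a12 x y r 1 2 hrx hry hr1 3 (by norm_num))
  have b03 := neg_le_of_abs_le (mono_bound F.a03 x y r 0 3 hrx hry hr1 3 (by norm_num))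
  have h2 : δ * (r ^ 2) ^ 2 - M * r ^ 3 ≤ F.ev x y := by
    rw [Q4.ev, hM]; linarith
  have h3 : r ^ 2 ≤ δ * (r ^ 2) ^ 2 - M * r ^ 3 := by
    have e : δ * (r ^ 2) ^ 2 - M * r ^ 3 = r ^ 3 * (δ * r - M) := by ring
    rw [e]
    have : r ^ 2 ≤ r ^ 3 := pow_le_pow_right₀ hr1 (by norm_num)
    have : r ^ 3 * 1 ≤ r ^ 3 * (δ * r - M) := by gcongr; linarith
    linarith
  nlinarith [sq_nonneg (y:ℝ)]

end

section

open Polynomial in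
lemma double_root (F : Q4) (h04 : 0 < F.a04) (hnn : ∀ s, 0 ≤ F.f4 s) 
    (hnr : ∀ ρ : ℚ, F.a40 + F.a31 * ρ + F.a22 * ρ ^ 2 + F.a13 * ρ ^ 3 + F.a04 * ρ ^ 4 ≠ 0)
    (α : ℝ) (hα : F.f4 α = 0) : ∃ β γ : ℚ, α ^ 2 + β * α + γ = 0 ∧ Irrational α ∧
      F.a13 = 2 * F.a04 * β ∧ F.a22 = F.a04 * (β ^ 2 + 2 * γ) ∧ F.a31 = 2 * F.a04 * β * γ ∧ F.a40 = F.a04 * γ ^ 2 := by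
  set f : ℚ[X] := C F.a04 * X ^ 4 + C F.a13 * X ^ 3 + C F.a22 * X ^ 2 + C F.a31 * X + C F.a40 with hf
  have hfr : ∀ ρ : ℚ, f.eval ρ ≠ 0 := by
    intro ρ h0
    apply hnr ρ
    simp [hf] at h0
    linarith
  have hfα : ∀ s : ℝ, aeval s f = F.f4 s := by
    intro s; simp [hf, Q4.f4]; ring
  have hc4 : f.coeff 4 = F.a04 := by simp [hf]
  have hd : f.natDegree = 4 := natDegree_eq_of_le_of_coeff_ne_zero (by rw [hf]; compute_degree) (by rw [hc4]; exact h04.ne')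
  have hf0 : f ≠ 0 := by intro h0; rw [h0] at hd; simp at hd
  have hroot : aeval α f = 0 := by rw [hfα, hα]
  have hintg : IsIntegral ℚ α := (show IsAlgebraic ℚ α from ⟨f, hf0, hroot⟩).isIntegral
  have hder : aeval α (derivative f) = 0 := by
    have h1 : HasDerivAt (fun s => aeval s f) (aeval α (derivative f)) α := Polynomial.hasDerivAt_aeval f α
    have hmin : IsLocalMin (fun s : ℝ => aeval s f) α := by
      refine Filter.Eventually.of_forall fun s => ?_
      show aeval α f ≤ aeval s f
      rw [hroot, hfα]; exact hnn s
    exact hmin.hasDerivAt_eq_zero h1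
  set g := minpoly ℚ α with hg
  have hgm : g.Monic := minpoly.monic hintg
  have hgi : Irreducible g := minpoly.irreducible hintg
  have hgf : g ∣ f := minpoly.dvd ℚ α hroot
  have hgf' : g ∣ derivative f := minpoly.dvd ℚ α hder
  have hd' : (derivative f).natDegree = 3 := by rw [natDegree_derivative, hd]
  have hf'0 : derivative f ≠ 0 := by intro h0; rw [h0] at hd'; simp at hd'
  have hg3 : g.natDegree ≤ 3 := by rw [← hd']; exact natDegree_le_of_dvd hgf' hf'0
  have hg1 : 1 ≤ g.natDegree := hgi.natDegree_pos
  have hnr' : ∀ k : ℚ[X], k ∣ f → k.natDegree ≠ 1 := by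
    intro k hk h1
    obtain ⟨ρ, hρ⟩ := Polynomial.exists_root_of_degree_eq_one ((degree_eq_iff_natDegree_eq_of_pos one_pos).2 h1)
    obtain ⟨l, hl⟩ := hk
    exact hfr ρ (by rw [hl, eval_mul, hρ.eq_zero, zero_mul])
  obtain ⟨k, hk⟩ := hgf
  have hk0 : k ≠ 0 := by rintro rfl; rw [mul_zero] at hk; exact hf0 hk
  have hdk : g.natDegree + k.natDegree = 4 := by rw [← natDegree_mul hgi.ne_zero hk0, ← hk, hd]
  have hg2 : g.natDegree = 2 := by
    have h1 := hnr' g ⟨k, hk⟩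
    have h2 := hnr' k ⟨g, by rw [hk, mul_comm]⟩
    omega
  have hgd : ¬ g ∣ derivative g := by
    intro hdv
    have h1 : (derivative g).natDegree = 1 := by rw [natDegree_derivative, hg2]
    have h2 : derivative g ≠ 0 := by intro h0; rw [h0] at h1; simp at h1
    have := natDegree_le_of_dvd hdv h2
    omega
  have hgk : g ∣ k := by
    rw [hk, derivative_mul] at hgf'
    have h1 : g ∣ derivative g * k := by
      have := dvd_sub hgf' (dvd_mul_right g (derivative k))
      rwa [add_sub_cancel_right] at this
    exact (hgi.prime.dvd_or_dvd h1).resolve_left hgd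
  obtain ⟨c, hc⟩ := hgk
  have hc0 : c ≠ 0 := by rintro rfl; rw [mul_zero] at hc; exact hk0 hc
  have hcd : c.natDegree = 0 := by
    have := natDegree_mul hgi.ne_zero hc0
    rw [← hc] at this; omega
  rw [eq_C_of_natDegree_eq_zero hcd] at hc
  set c0 := c.coeff 0
  have hge : g = X ^ 2 + C (g.coeff 1) * X + C (g.coeff 0) := by
    have h2 : g.coeff 2 = 1 := by rw [← hg2]; exact hgm.coeff_natDegree
    conv_lhs => rw [g.as_sum_range, hg2]
    rw [Finset.sum_range_succ, Finset.sum_range_succ, Finset.sum_range_succ, Finset.sum_range_zero, h2]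
    simp only [← C_mul_X_pow_eq_monomial]
    simp; ring
  set β := g.coeff 1
  set γ := g.coeff 0
  have hfe : f = C c0 * X ^ 4 + C (2 * c0 * β) * X ^ 3 + C (c0 * (β ^ 2 + 2 * γ)) * X ^ 2 + C (2 * c0 * β * γ) * X + C (c0 * γ ^ 2) := by
    rw [hk, hc, hge]
    simp only [C_mul, C_add, C_pow]
    have : (C (2:ℚ) : ℚ[X]) = 2 := rfl
    rw [this]
    ring
  have e4 := congrArg (fun p => coeff p 4) hfe
  have e3 := congrArg (fun p => coeff p 3) hfe
  have e2 := congrArg (fun p => coeff p 2) hfe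
  have e1 := congrArg (fun p => coeff p 1) hfe
  have e0 := congrArg (fun p => coeff p 0) hfe
  simp only [hf, coeff_add, coeff_C_mul, coeff_X_pow, coeff_C, coeff_X] at e4 e3 e2 e1 e0
  norm_num at e4 e3 e2 e1 e0
  refine ⟨β, γ, ?_, ?_, ?_, ?_, ?_, ?_⟩
  · have := minpoly.aeval ℚ α
    rw [← hg, hge] at this
    simpa using this
  · rintro ⟨ρ, hρ⟩
    apply hfr ρ
    have h1 : aeval (ρ:ℝ) f = 0 := by rw [hρ, hroot]
    have h2 : aeval (algebraMap ℚ ℝ ρ) f = 0 := h1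
    rw [aeval_algebraMap_apply] at h2
    simpa using h2
  · rw [e3, e4]
  · rw [e2, e4]
  · rw [e1, e4]
  · rw [e0, e4]

end

section

open Filter Topology in
lemma orbit (β γ x0 y0 : ℚ) (α : ℝ) (hirr : Irrational α) (hα : α ^ 2 + β * α + γ = 0) :
    ∃ (xs ys : ℕ → ℤ) (q0 : ℝ), 
      (∀ n, ((ys n:ℝ) - y0) ^ 2 + β * ((xs n:ℝ) - x0) * ((ys n:ℝ) - y0) + γ * ((xs n:ℝ) - x0) ^ 2 = q0) ∧
      Tendsto (fun n => (xs n:ℝ) - x0) atTop atTop ∧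
      Tendsto (fun n => ((ys n:ℝ) - y0) / ((xs n:ℝ) - x0)) atTop (𝓝 α) := by
  set θ : ℝ := 2 * α + β with hθ
  set k : ℕ := β.den * γ.den with hk
  have hk0 : 0 < k := Nat.mul_pos β.den_pos γ.den_pos
  have hkR : (0:ℝ) < k := by exact_mod_cast hk0
  obtain ⟨b, hb⟩ := rat_clear β k ⟨γ.den, rfl⟩
  obtain ⟨c, hc⟩ := rat_clear γ k ⟨β.den, by rw [hk]; ring⟩
  set m : ℕ := x0.den * y0.den with hm
  have hm0 : 0 < m := Nat.mul_pos x0.den_pos y0.den_pos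
  have hmR : (0:ℝ) < m := by exact_mod_cast hm0
  obtain ⟨p0, hp0⟩ := rat_clear x0 m ⟨y0.den, rfl⟩
  obtain ⟨r0, hr0⟩ := rat_clear y0 m ⟨x0.den, by rw [hm]; ring⟩
  set Δ : ℤ := b ^ 2 - 4 * k * c with hΔ
  have hΔR : (Δ:ℝ) = (k * θ) ^ 2 := by
    rw [hΔ, hθ]; push_cast; rw [hb, hc]; linear_combination -4 * (k:ℝ) ^ 2 * hα
  have hθirr : ∀ q : ℚ, θ ≠ q := by
    intro q hq
    apply hirr
    refine ⟨(q - β) / 2, ?_⟩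
    push_cast
    rw [← hq, hθ]; ring
  have hθ0 : θ ≠ 0 := by simpa using hθirr 0
  have hns : ¬ IsSquare (Δ * (m:ℤ) ^ 2) := by
    rintro ⟨w, hw⟩
    have hw' : (k * m * θ) ^ 2 = (w:ℝ) ^ 2 := by
      have : ((Δ * (m:ℤ) ^ 2 : ℤ) : ℝ) = ((w * w : ℤ) : ℝ) := by rw [hw]
      push_cast at this
      rw [hΔR] at this
      linear_combination this
    rcases sq_eq_sq_iff_eq_or_eq_neg.1 hw' with h | h
    · apply hθirr (w / (k * m))
      push_cast
      rw [← h]; field_simp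
    · apply hθirr (-w / (k * m))
      push_cast
      rw [← h]; field_simp
  have hpos : 0 < Δ * (m:ℤ) ^ 2 := by
    have : (0:ℝ) < ((Δ * (m:ℤ) ^ 2 : ℤ) : ℝ) := by push_cast; rw [hΔR]; positivity
    exact_mod_cast this
  obtain ⟨t, u', htu', hu'⟩ := Pell.exists_of_not_isSquare hpos hns
  obtain ⟨u, htu, huθ⟩ : ∃ u : ℤ, t ^ 2 - Δ * (m:ℤ) ^ 2 * u ^ 2 = 1 ∧ 0 < (t * u) * θ := by
    have ht0 : t ≠ 0 := by rintro rfl; nlinarith [sq_nonneg u']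
    have htR : (t:ℝ) ≠ 0 := by exact_mod_cast ht0
    have huR : (u':ℝ) ≠ 0 := by exact_mod_cast hu'
    have hne : ((t:ℝ) * u') * θ ≠ 0 := by positivity
    rcases lt_or_gt_of_ne hne with h | h
    · exact ⟨-u', by linarith, by push_cast; linarith⟩
    · exact ⟨u', htu', h⟩
  have htuR : (t:ℝ) ^ 2 - (k * θ) ^ 2 * (m:ℝ) ^ 2 * u ^ 2 = 1 := by
    rw [← hΔR]; exact_mod_cast htu
  set T : ℤ := 1 + 2 * Δ * m ^ 2 * u ^ 2 with hT
  set V : ℤ := 2 * t * u with hV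
  set ρ' : ℝ := T + (m * V) * (k * θ) with hρ'
  set ρ : ℝ := T - (m * V) * (k * θ) with hρ
  have hTR : (T:ℝ) = 1 + 2 * (k * θ) ^ 2 * m ^ 2 * u ^ 2 := by rw [hT]; push_cast; rw [hΔR]
  have hVR : (V:ℝ) = 2 * t * u := by rw [hV]; push_cast; ring
  have hprod : ρ * ρ' = 1 := by
    rw [hρ, hρ', hTR, hVR]
    linear_combination (-4 * (k * θ) ^ 2 * (m:ℝ) ^ 2 * u ^ 2) * htuR
  have hρ'1 : 1 < ρ' := by
    rw [hρ', hTR, hVR]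
    have h1 : 0 ≤ 2 * (k * θ) ^ 2 * (m:ℝ) ^ 2 * u ^ 2 := by positivity
    have h2 : 0 < 2 * (m:ℝ) * k * ((t * u) * θ) := by positivity
    linarith
  have hρ'0 : 0 < ρ' := by linarith
  have hρe : ρ = ρ'⁻¹ := eq_inv_of_mul_eq_one_left hprod
  have hρ0 : 0 ≤ ρ := by rw [hρe]; positivity
  have hρ1 : ρ < 1 := by rw [hρe]; exact inv_lt_one_of_one_lt₀ hρ'1
  set α' : ℝ := - β - α with hα'
  obtain ⟨s, hs⟩ : ∃ s : ℤ, 0 < ((s:ℝ) - y0 + α' * x0) / θ := by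
    rcases lt_or_gt_of_ne hθ0 with h | h
    · obtain ⟨s, hs⟩ := exists_int_lt (y0 - α' * x0 : ℝ)
      exact ⟨s, div_pos_of_neg_of_neg (by linarith) h⟩
    · obtain ⟨s, hs⟩ := exists_int_gt (y0 - α' * x0 : ℝ)
      exact ⟨s, div_pos (by linarith) h⟩
  set f : ℤ × ℤ → ℤ × ℤ := fun p => 
    (T * p.1 + m * V * (2 * k * p.2 + b * p.1) - 2 * Δ * m * u ^ 2 * p0 - V * (2 * k * r0 + b * p0),
     T * p.2 - m * V * (b * p.2 + 2 * c * p.1) - 2 * Δ * m * u ^ 2 * r0 + V * (b * r0 + 2 * c * p0)) with hf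
  set z : ℕ → ℤ × ℤ := fun n => f^[n] (0, s) with hz
  have hzs : ∀ n, z (n + 1) = f (z n) := fun n => Function.iterate_succ_apply' f n _
  set L : ℕ → ℝ := fun n => (((z n).2:ℝ) - y0) - α * (((z n).1:ℝ) - x0) with hL
  set L' : ℕ → ℝ := fun n => (((z n).2:ℝ) - y0) - α' * (((z n).1:ℝ) - x0) with hL'
  have hX1 : ∀ n, ((z (n+1)).1:ℝ) - x0 = T * (((z n).1:ℝ) - x0) + m * V * (2 * k * (((z n).2:ℝ) - y0) + b * (((z n).1:ℝ) - x0)) := by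
    intro n
    rw [hzs, hf]; push_cast; rw [hp0, hr0, hTR, hΔR]; ring
  have hY1 : ∀ n, ((z (n+1)).2:ℝ) - y0 = T * (((z n).2:ℝ) - y0) - m * V * (b * (((z n).2:ℝ) - y0) + 2 * c * (((z n).1:ℝ) - x0)) := by
    intro n
    rw [hzs, hf]; push_cast; rw [hp0, hr0, hTR, hΔR]; ring
  have hLs : ∀ n, L (n + 1) = ρ * L n := by
    intro n
    simp only [hL]
    rw [hX1, hY1, hρ, hθ, hb, hc]
    linear_combination -(2 * (m:ℝ) * V * k * (((z n).1:ℝ) - x0)) * hα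
  have hLs' : ∀ n, L' (n + 1) = ρ' * L' n := by
    intro n
    simp only [hL', hα']
    rw [hX1, hY1, hρ', hθ, hb, hc]
    linear_combination -(2 * (m:ℝ) * V * k * (((z n).1:ℝ) - x0)) * hα
  have hLn : ∀ n, L n = ρ ^ n * L 0 := by
    intro n
    induction n with
    | zero => simp
    | succ n ih => rw [hLs, ih]; ring
  have hLn' : ∀ n, L' n = ρ' ^ n * L' 0 := by
    intro n
    induction n with
    | zero => simp
    | succ n ih => rw [hLs', ih]; ring
  have hL0' : 0 < L' 0 / θ := by
    have : L' 0 = (s:ℝ) - y0 + α' * x0 := by simp [hL', hz]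
    rw [this]; exact hs
  have hXn : ∀ n, ((z n).1:ℝ) - x0 = ρ' ^ n * (L' 0 / θ) - ρ ^ n * L 0 / θ := by
    intro n
    have e : θ * (((z n).1:ℝ) - x0) = L' n - L n := by
      simp only [hL, hL', hα', hθ]; ring
    rw [hLn, hLn'] at e
    field_simp
    linear_combination e
  have hXt : Tendsto (fun n => ((z n).1:ℝ) - x0) atTop atTop := by
    simp_rw [hXn, sub_eq_add_neg]
    have h1 : Tendsto (fun n => ρ' ^ n * (L' 0 / θ)) atTop atTop :=
      (tendsto_pow_atTop_atTop_of_one_lt hρ'1).atTop_mul_const hL0'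
    have h2 : Tendsto (fun n => -(ρ ^ n * L 0 / θ)) atTop (𝓝 (-(0 * L 0 / θ))) :=
      (((tendsto_pow_atTop_nhds_zero_of_lt_one hρ0 hρ1).mul_const _).div_const _).neg
    exact h1.atTop_add h2
  refine ⟨fun n => (z n).1, fun n => (z n).2, L 0 * L' 0, ?_, hXt, ?_⟩
  · intro n
    have e : (((z n).2:ℝ) - y0) ^ 2 + β * (((z n).1:ℝ) - x0) * (((z n).2:ℝ) - y0) + γ * (((z n).1:ℝ) - x0) ^ 2 = L n * L' n := by
      simp only [hL, hL', hα']
      linear_combination (((z n).1:ℝ) - x0) ^ 2 * hα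
    rw [e, hLn, hLn']
    calc ρ ^ n * L 0 * (ρ' ^ n * L' 0) = (ρ * ρ') ^ n * (L 0 * L' 0) := by ring
      _ = _ := by rw [hprod]; ring
  · have h1 : Tendsto (fun n => ρ ^ n * L 0) atTop (𝓝 (0 * L 0)) :=
      (tendsto_pow_atTop_nhds_zero_of_lt_one hρ0 hρ1).mul_const _
    have h2 : Tendsto (fun n => α + (ρ ^ n * L 0) / (((z n).1:ℝ) - x0)) atTop (𝓝 (α + 0)) :=
      (h1.div_atTop hXt).const_add α
    rw [add_zero] at h2
    refine h2.congr' ?_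
    filter_upwards [hXt.eventually_gt_atTop 0] with n hn
    rw [← hLn]
    simp only [hL]
    field_simp
    ring

end

section

open Filter Topology

lemma lin_irr (α : ℝ) (hirr : Irrational α) (p q : ℚ) (h : (p:ℝ) * α + q = 0) : p = 0 ∧ q = 0 := by
  have hp : p = 0 := by
    by_contra hp
    have hpR : (p:ℝ) ≠ 0 := by exact_mod_cast hp
    apply hirr
    refine ⟨-q / p, ?_⟩
    push_cast
    field_simp
    linarith
  refine ⟨hp, ?_⟩
  rw [hp] at h
  simpa using h

lemma orbit_pos (β γ x0 y0 : ℚ) (α : ℝ) (hirr : Irrational α) (hα : α ^ 2 + β * α + γ = 0)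
    (W : ℝ → ℝ → ℝ → ℝ) (hW : ∀ q, Continuous (fun p : ℝ × ℝ => W q p.1 p.2))
    (h : ∀ x y : ℤ, 0 < (x:ℝ) - x0 → 0 ≤ W (((y:ℝ) - y0) ^ 2 + β * ((x:ℝ) - x0) * ((y:ℝ) - y0) + γ * ((x:ℝ) - x0) ^ 2)
      (((x:ℝ) - x0)⁻¹) (((y:ℝ) - y0) / ((x:ℝ) - x0))) : ∃ q, 0 ≤ W q 0 α := by
  obtain ⟨xs, ys, q0, hq, hX, ht⟩ := orbit β γ x0 y0 α hirr hα
  refine ⟨q0, ?_⟩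
  have h1 : Tendsto (fun n => ((((xs n:ℝ) - x0)⁻¹, ((ys n:ℝ) - y0) / ((xs n:ℝ) - x0)) : ℝ × ℝ)) atTop (𝓝 (0, α)) :=
    (tendsto_inv_atTop_zero.comp hX).prodMk_nhds ht
  have h2 := ((hW q0).tendsto (0, α)).comp h1
  refine ge_of_tendsto h2 ?_
  filter_upwards [hX.eventually_gt_atTop 0] with n hn
  have := h (xs n) (ys n) hn
  rw [hq] at this
  exact this

lemma orbit_neg (β γ x0 y0 : ℚ) (α : ℝ) (hirr : Irrational α) (hα : α ^ 2 + β * α + γ = 0)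
    (W : ℝ → ℝ → ℝ → ℝ) (hW : ∀ q, Continuous (fun p : ℝ × ℝ => W q p.1 p.2))
    (h : ∀ x y : ℤ, (x:ℝ) - x0 < 0 → 0 ≤ W (((y:ℝ) - y0) ^ 2 + β * ((x:ℝ) - x0) * ((y:ℝ) - y0) + γ * ((x:ℝ) - x0) ^ 2)
      (((x:ℝ) - x0)⁻¹) (((y:ℝ) - y0) / ((x:ℝ) - x0))) : ∃ q, 0 ≤ W q 0 α := by
  have := orbit_pos β γ (-x0) (-y0) α hirr hα (fun q s t => W q (-s) t) (fun q => by
    have := (hW q).comp (show Continuous (fun p : ℝ × ℝ => ((-p.1, p.2) : ℝ × ℝ)) by fun_prop)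
    exact this) (by
    intro x y hx
    push_cast at hx ⊢
    have h1 := h (-x) (-y) (by push_cast; linarith)
    push_cast at h1
    have e1 : (-(x:ℝ) - x0) = -((x:ℝ) - -x0) := by ring
    have e2 : (-(y:ℝ) - y0) = -((y:ℝ) - -y0) := by ring
    rw [e1, e2, inv_neg, neg_div_neg_eq] at h1
    convert h1 using 2
    ring)
  simpa using this

set_option maxHeartbeats 1000000 in
/-- the normal form case -/
lemma caseQ (F : Q4) (hF : F.NN) (h04 : 0 < F.a04) (β γ x0 y0 b20 b11 b02 b10 b01 b00 : ℚ) (α : ℝ)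
    (hirr : Irrational α) (hα : α ^ 2 + β * α + γ = 0)
    (hev : ∀ x y : ℝ, F.ev x y = F.a04 * ((y - y0) ^ 2 + β * (x - x0) * (y - y0) + γ * (x - x0) ^ 2) ^ 2
      + (b20 * (x - x0) ^ 2 + b11 * (x - x0) * (y - y0) + b02 * (y - y0) ^ 2) + (b10 * (x - x0) + b01 * (y - y0)) + b00) :
    SmallSet F.vals := by
  have h04R : (0:ℝ) < F.a04 := by exact_mod_cast h04
  have h2 : ∀ a : ℝ, Irrational a → a ^ 2 + β * a + γ = 0 → 0 ≤ (b20:ℝ) + b11 * a + b02 * a ^ 2 := by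
    intro a ha hra
    obtain ⟨q, hq⟩ := orbit_pos β γ x0 y0 a ha hra
      (fun q s t => F.a04 * q ^ 2 * s ^ 2 + (b20 + b11 * t + b02 * t ^ 2) + (b10 + b01 * t) * s + b00 * s ^ 2)
      (by intro q; fun_prop) (by
      intro x y hx
      have h := hF x y
      rw [hev] at h
      set X := (x:ℝ) - x0
      set Y := (y:ℝ) - y0
      have : 0 ≤ (F.a04 * (Y ^ 2 + β * X * Y + γ * X ^ 2) ^ 2
      + (b20 * X ^ 2 + b11 * X * Y + b02 * Y ^ 2) + (b10 * X + b01 * Y) + b00) / X ^ 2 := by positivity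
      convert this using 1
      field_simp)
    simpa using hq
  set α' : ℝ := -β - α with hα'
  have hirr' : Irrational α' := by
    rw [hα', show -(β:ℝ) - α = ((-β:ℚ):ℝ) - α by push_cast; ring]
    exact hirr.ratCast_sub _
  have hrα' : α' ^ 2 + β * α' + γ = 0 := by rw [hα']; linear_combination hα
  have e2 : (b20:ℝ) + b11 * α + b02 * α ^ 2 = ((b11 - b02 * β : ℚ):ℝ) * α + ((b20 - b02 * γ : ℚ) : ℝ) := by
    push_cast; linear_combination b02 * hα
  have e2' : (b20:ℝ) + b11 * α' + b02 * α' ^ 2 = ((b11 - b02 * β : ℚ):ℝ) * α' + ((b20 - b02 * γ : ℚ) : ℝ) := by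
    push_cast; linear_combination b02 * hrα'
  by_cases hz : b11 = b02 * β ∧ b20 = b02 * γ
  · obtain ⟨hz1, hz2⟩ := hz
    have hev' : ∀ x y : ℝ, F.ev x y = F.a04 * ((y - y0) ^ 2 + β * (x - x0) * (y - y0) + γ * (x - x0) ^ 2) ^ 2
      + b02 * ((y - y0) ^ 2 + β * (x - x0) * (y - y0) + γ * (x - x0) ^ 2) + (b10 * (x - x0) + b01 * (y - y0)) + b00 := by
      intro x y; rw [hev, hz1, hz2]; push_cast; ring
    have hp : 0 ≤ (b10:ℝ) + b01 * α := by
      obtain ⟨q, hq⟩ := orbit_pos β γ x0 y0 α hirr hα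
        (fun q s t => F.a04 * q ^ 2 * s + b02 * q * s + (b10 + b01 * t) + b00 * s)
        (by intro q; fun_prop) (by
        intro x y hx
        have h := hF x y
        rw [hev'] at h
        set X := (x:ℝ) - x0
        set Y := (y:ℝ) - y0
        have : 0 ≤ (F.a04 * (Y ^ 2 + β * X * Y + γ * X ^ 2) ^ 2
          + b02 * (Y ^ 2 + β * X * Y + γ * X ^ 2) + (b10 * X + b01 * Y) + b00) / X := by positivity
        convert this using 1
        field_simp)
      simpa using hq
    have hn : 0 ≤ -((b10:ℝ) + b01 * α) := by
      obtain ⟨q, hq⟩ := orbit_neg β γ x0 y0 α hirr hα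
        (fun q s t => -(F.a04 * q ^ 2 * s + b02 * q * s + (b10 + b01 * t) + b00 * s))
        (by intro q; fun_prop) (by
        intro x y hx
        have h := hF x y
        rw [hev'] at h
        set X := (x:ℝ) - x0
        set Y := (y:ℝ) - y0
        have : 0 ≤ (F.a04 * (Y ^ 2 + β * X * Y + γ * X ^ 2) ^ 2
          + b02 * (Y ^ 2 + β * X * Y + γ * X ^ 2) + (b10 * X + b01 * Y) + b00) / (-X) := div_nonneg h (by linarith)
        have hX : X ≠ 0 := hx.ne
        convert this using 1
        field_simp)
      simpa using hq
    obtain ⟨hb01, hb10⟩ := lin_irr α hirr b01 b10 (by linarith)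
    set z : ℕ := β.den * γ.den * (x0.den * y0.den) ^ 2 with hzd
    have hz0 : 0 < z := by simp [hzd, β.den_pos, γ.den_pos, x0.den_pos, y0.den_pos]
    have hzR : (0:ℝ) < z := by exact_mod_cast hz0
    open Polynomial in
    set P : ℝ[X] := C ((F.a04:ℝ) / z ^ 2) * X ^ 2 + C ((b02:ℝ) / z) * X + C (b00:ℝ) with hP
    have hd : P.natDegree = 2 := by
      rw [hP]; exact Polynomial.natDegree_quadratic (by positivity)
    refine (small_poly P hd.ge).mono ?_
    rintro m ⟨x, y, hm⟩
    have hβ : (β:ℝ) * β.den = β.num := by exact_mod_cast Rat.mul_den_eq_num β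
    have hγ : (γ:ℝ) * γ.den = γ.num := by exact_mod_cast Rat.mul_den_eq_num γ
    have hx0 : (x0:ℝ) * x0.den = x0.num := by exact_mod_cast Rat.mul_den_eq_num x0
    have hy0 : (y0:ℝ) * y0.den = y0.num := by exact_mod_cast Rat.mul_den_eq_num y0
    refine ⟨β.den * γ.den * (x0.den * (y * y0.den - y0.num)) ^ 2 + β.num * γ.den * (x0.den * (y * y0.den - y0.num)) * (y0.den * (x * x0.den - x0.num))
      + γ.num * β.den * (y0.den * (x * x0.den - x0.num)) ^ 2, ?_⟩
    rw [← hm, hev', hb01, hb10, hP]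
    have key : ((β.den * γ.den * (x0.den * (y * y0.den - y0.num)) ^ 2 + β.num * γ.den * (x0.den * (y * y0.den - y0.num)) * (y0.den * (x * x0.den - x0.num))
      + γ.num * β.den * (y0.den * (x * x0.den - x0.num)) ^ 2 : ℤ) : ℝ) = z * (((y:ℝ) - y0) ^ 2 + β * ((x:ℝ) - x0) * ((y:ℝ) - y0) + γ * ((x:ℝ) - x0) ^ 2) := by
      push_cast
      rw [← hβ, ← hγ, ← hx0, ← hy0, hzd]
      push_cast
      ring
    rw [key]
    simp only [Polynomial.eval_add, Polynomial.eval_mul, Polynomial.eval_C, Polynomial.eval_pow, Polynomial.eval_X]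
    field_simp
    push_cast
    ring
  · have hp : 0 < (b20:ℝ) + b11 * α + b02 * α ^ 2 := by
      refine lt_of_le_of_ne (h2 α hirr hα) fun h0 => hz ?_
      rw [e2] at h0
      obtain ⟨h3, h4⟩ := lin_irr α hirr _ _ h0.symm
      exact ⟨by linarith, by linarith⟩
    have hp' : 0 < (b20:ℝ) + b11 * α' + b02 * α' ^ 2 := by
      refine lt_of_le_of_ne (h2 α' hirr' hrα') fun h0 => hz ?_
      rw [e2'] at h0
      obtain ⟨h3, h4⟩ := lin_irr α' hirr' _ _ h0.symm
      exact ⟨by linarith, by linarith⟩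
    obtain ⟨K, hK, hKp⟩ := circle_combo (fun p => (p.2 ^ 2 + β * p.1 * p.2 + γ * p.1 ^ 2) ^ 2)
      (fun p => (b20 * p.1 ^ 2 + b11 * p.1 * p.2 + b02 * p.2 ^ 2) * (p.1 ^ 2 + p.2 ^ 2)) (by fun_prop) (by fun_prop)
      (fun p => by positivity) (by
        rintro ⟨X, Y⟩ h1 h0
        simp only at h1 h0 ⊢
        have h0 : Y ^ 2 + β * X * Y + γ * X ^ 2 = 0 := by simpa using h0
        rw [h1, mul_one]
        have hX : X ≠ 0 := by
          rintro rfl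
          have : Y = 0 := by simpa using h0
          rw [this] at h1; norm_num at h1
        have h5 : (Y - α * X) * (Y - α' * X) = 0 := by
          rw [hα']; linear_combination h0 - X ^ 2 * hα
        have hX2 : 0 < X ^ 2 := by positivity
        rcases mul_eq_zero.1 h5 with h6 | h6
        · have : Y = α * X := by linarith
          rw [this]
          have := mul_pos hX2 hp
          nlinarith
        · have : Y = α' * X := by linarith
          rw [this]
          have := mul_pos hX2 hp'
          nlinarith)
    obtain ⟨δ, hδ, hl⟩ := circle_lower (fun X Y => K * (Y ^ 2 + β * X * Y + γ * X ^ 2) ^ 2 + 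
      (b20 * X ^ 2 + b11 * X * Y + b02 * Y ^ 2) * (X ^ 2 + Y ^ 2)) (by fun_prop) (by intro l x y; ring)
      (fun x y hxy => hKp (x, y) hxy)
    set M : ℝ := |(b10:ℝ)| + |(b01:ℝ)| + |(b00:ℝ)| with hM
    have hM0 : 0 ≤ M := by positivity
    refine growth_small F hF h04.ne' (2 * |(x0:ℝ)| + K / F.a04 + 2 * M / δ + 1) (δ / 8) (by positivity) (by positivity) ?_
    intro x y hx
    rw [hev]
    set X := (x:ℝ) - x0 with hX
    set Y := (y:ℝ) - y0 with hY
    set r := Real.sqrt (X ^ 2 + Y ^ 2) with hr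
    have hr2 : r ^ 2 = X ^ 2 + Y ^ 2 := Real.sq_sqrt (by positivity)
    have hrX : |X| ≤ r := Real.abs_le_sqrt (by nlinarith [sq_nonneg Y])
    have hrY : |Y| ≤ r := Real.abs_le_sqrt (by nlinarith [sq_nonneg X])
    have hd0 : 0 ≤ 2 * M / δ := by positivity
    have hK0 : 0 ≤ K / F.a04 := by positivity
    have hxX : |(x:ℝ)| ≤ |X| + |(x0:ℝ)| := by
      have := abs_add_le X (x0:ℝ)
      rwa [hX, sub_add_cancel] at this
    have hx0 : 0 ≤ |(x0:ℝ)| := abs_nonneg _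
    have hr1 : 1 ≤ r := by linarith
    have hrK : K ≤ F.a04 * r := by
      have : K / F.a04 ≤ r := by linarith
      rw [div_le_iff₀ h04R] at this; linarith
    have hrM : 2 * M ≤ δ * r := by
      have : 2 * M / δ ≤ r := by linarith
      rw [div_le_iff₀ hδ] at this; linarith
    have hx2 : (x:ℝ) ^ 2 ≤ 4 * r ^ 2 := by
      have h1 : |(x:ℝ)| ≤ 2 * r := by linarith
      have h2 : |(x:ℝ)| ^ 2 ≤ (2 * r) ^ 2 := by gcongr
      rw [sq_abs] at h2; linarith
    have hlin : -(M * r) ≤ (b10 * X + b01 * Y) + b00 := by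
      have h1 := mono_bound b10 X Y r 1 0 hrX hrY hr1 1 (by norm_num)
      have h2 := mono_bound b01 X Y r 0 1 hrX hrY hr1 1 (by norm_num)
      have h3 := mono_bound b00 X Y r 0 0 hrX hrY hr1 1 (by norm_num)
      simp only [pow_one, pow_zero, mul_one] at h1 h2 h3
      have h1 := neg_le_of_abs_le h1
      have h2 := neg_le_of_abs_le h2
      have h3 := neg_le_of_abs_le h3
      rw [hM]; linarith
    have hKr : K ≤ F.a04 * r ^ 2 := by
      have : F.a04 * r ≤ F.a04 * r ^ 2 := by
        gcongr; nlinarith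
      linarith
    have hl1 := hl X Y
    rw [← hr2] at hl1
    set Q := (Y ^ 2 + β * X * Y + γ * X ^ 2) with hQ
    set R2 := (b20 * X ^ 2 + b11 * X * Y + b02 * Y ^ 2) with hR2
    have hq : K * Q ^ 2 ≤ F.a04 * r ^ 2 * Q ^ 2 := by gcongr
    have hr2p : 0 < r ^ 2 := by positivity
    have h7 : δ * r ^ 2 ≤ F.a04 * Q ^ 2 + R2 := by
      have : r ^ 2 * (δ * r ^ 2) ≤ r ^ 2 * (F.a04 * Q ^ 2 + R2) := by linarith
      exact le_of_mul_le_mul_left this hr2p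
    have h8 : 2 * M * r ≤ δ * r * r := by gcongr
    have h9 : δ * (x:ℝ) ^ 2 ≤ δ * (4 * r ^ 2) := by gcongr
    linarith

lemma caseII2 (F : Q4) (hF : F.NN) (h04 : 0 < F.a04) (β γ : ℚ) (α : ℝ)
    (hirr : Irrational α) (hα : α ^ 2 + β * α + γ = 0) (h13 : F.a13 = 2 * F.a04 * β)
    (h22 : F.a22 = F.a04 * (β ^ 2 + 2 * γ)) (h31 : F.a31 = 2 * F.a04 * β * γ) (h40 : F.a40 = F.a04 * γ ^ 2) :
    SmallSet F.vals := by
  have h04R : (0:ℝ) < F.a04 := by exact_mod_cast h04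
  have hev : ∀ x y : ℝ, F.ev x y = F.a04 * (y ^ 2 + β * x * y + γ * x ^ 2) ^ 2 
      + (F.a30 * x ^ 3 + F.a21 * x ^ 2 * y + F.a12 * x * y ^ 2 + F.a03 * y ^ 3)
      + (F.a20 * x ^ 2 + F.a11 * x * y + F.a02 * y ^ 2) + (F.a10 * x + F.a01 * y) + F.a00 := by
    intro x y
    rw [Q4.ev, h13, h22, h31, h40]; push_cast; ring
  have hp : 0 ≤ (F.a30:ℝ) + F.a21 * α + F.a12 * α ^ 2 + F.a03 * α ^ 3 := by
    obtain ⟨q, hq⟩ := orbit_pos β γ 0 0 α hirr hα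
      (fun q s t => F.a04 * q ^ 2 * s ^ 3 + (F.a30 + F.a21 * t + F.a12 * t ^ 2 + F.a03 * t ^ 3)
        + (F.a20 + F.a11 * t + F.a02 * t ^ 2) * s + (F.a10 + F.a01 * t) * s ^ 2 + F.a00 * s ^ 3)
      (by intro q; fun_prop) (by
      intro x y hx
      have h := hF x y
      rw [hev] at h
      simp only [Rat.cast_zero, sub_zero] at hx ⊢
      have : 0 ≤ (F.a04 * ((y:ℝ) ^ 2 + β * x * y + γ * x ^ 2) ^ 2 
      + (F.a30 * x ^ 3 + F.a21 * x ^ 2 * y + F.a12 * x * y ^ 2 + F.a03 * y ^ 3)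
      + (F.a20 * x ^ 2 + F.a11 * x * y + F.a02 * y ^ 2) + (F.a10 * x + F.a01 * y) + F.a00) / (x:ℝ) ^ 3 := by positivity
      convert this using 1
      field_simp)
    simpa using hq
  have hn : 0 ≤ -((F.a30:ℝ) + F.a21 * α + F.a12 * α ^ 2 + F.a03 * α ^ 3) := by
    obtain ⟨q, hq⟩ := orbit_neg β γ 0 0 α hirr hα
      (fun q s t => -(F.a04 * q ^ 2 * s ^ 3 + (F.a30 + F.a21 * t + F.a12 * t ^ 2 + F.a03 * t ^ 3)
        + (F.a20 + F.a11 * t + F.a02 * t ^ 2) * s + (F.a10 + F.a01 * t) * s ^ 2 + F.a00 * s ^ 3))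
      (by intro q; fun_prop) (by
      intro x y hx
      have h := hF x y
      rw [hev] at h
      simp only [Rat.cast_zero, sub_zero] at hx ⊢
      have hx3 : 0 < (-(x:ℝ)) ^ 3 := by
        have : 0 < -(x:ℝ) := by linarith
        positivity
      have hx' : (x:ℝ) ≠ 0 := hx.ne
      have : 0 ≤ (F.a04 * ((y:ℝ) ^ 2 + β * x * y + γ * x ^ 2) ^ 2 
      + (F.a30 * x ^ 3 + F.a21 * x ^ 2 * y + F.a12 * x * y ^ 2 + F.a03 * y ^ 3)
      + (F.a20 * x ^ 2 + F.a11 * x * y + F.a02 * y ^ 2) + (F.a10 * x + F.a01 * y) + F.a00) / (-(x:ℝ)) ^ 3 := 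
        div_nonneg h hx3.le
      convert this using 1
      rw [show (-(x:ℝ)) ^ 3 = -(x:ℝ) ^ 3 by ring]
      field_simp)
    simp only [ne_eq, OfNat.ofNat_ne_zero, not_false_eq_true, zero_pow, mul_zero, zero_add, add_zero] at hq
    exact hq
  obtain ⟨h1, h0⟩ := lin_irr α hirr (F.a21 - β * (F.a12 - β * F.a03) - γ * F.a03) (F.a30 - γ * (F.a12 - β * F.a03)) (by
    push_cast
    have : (F.a30:ℝ) + F.a21 * α + F.a12 * α ^ 2 + F.a03 * α ^ 3 = 0 := by linarith
    linear_combination this - (F.a03 * α + (F.a12 - β * F.a03)) * hα)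
  have hD : 4 * γ - β ^ 2 ≠ 0 := by
    intro hD
    have hDR : 4 * (γ:ℝ) - β ^ 2 = 0 := by exact_mod_cast hD
    have : (2 * α + β) ^ 2 = 0 := by linear_combination 4 * hα - hDR
    have h3 : 2 * α + β = 0 := by simpa using this
    have := (lin_irr α hirr 2 β (by push_cast; linarith)).1
    norm_num at this
  obtain ⟨x0, y0, hm0, hm1⟩ : ∃ x0 y0 : ℚ, F.a12 - β * F.a03 = -2 * F.a04 * (2 * γ * x0 + β * y0) ∧ 
      F.a03 = -2 * F.a04 * (β * x0 + 2 * y0) := by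
    have hc := h04.ne'
    obtain ⟨D, hDd⟩ : ∃ D, D = 4 * γ - β ^ 2 := ⟨_, rfl⟩
    rw [← hDd] at hD
    refine ⟨-(2 * (F.a12 - β * F.a03) - β * F.a03) / (2 * F.a04 * D),
      -(2 * γ * F.a03 - β * (F.a12 - β * F.a03)) / (2 * F.a04 * D), ?_, ?_⟩
    · field_simp; rw [hDd]; ring
    · field_simp; rw [hDd]; ring
  set m0 := 2 * γ * x0 + β * y0 with hm0d
  set m1 := β * x0 + 2 * y0 with hm1d
  set Q0 := y0 ^ 2 + β * x0 * y0 + γ * x0 ^ 2 with hQ0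
  set e20 := F.a20 - F.a04 * m0 ^ 2 - 2 * F.a04 * Q0 * γ with he20
  set e11 := F.a11 - 2 * F.a04 * m0 * m1 - 2 * F.a04 * Q0 * β with he11
  set e02 := F.a02 - F.a04 * m1 ^ 2 - 2 * F.a04 * Q0 with he02
  set e10 := F.a10 + 2 * F.a04 * Q0 * m0 with he10
  set e01 := F.a01 + 2 * F.a04 * Q0 * m1 with he01
  refine caseQ F hF h04 β γ x0 y0 e20 e11 e02 (e10 + 2 * e20 * x0 + e11 * y0) (e01 + e11 * x0 + 2 * e02 * y0)
    (F.a00 - F.a04 * Q0 ^ 2 + e20 * x0 ^ 2 + e11 * x0 * y0 + e02 * y0 ^ 2 + e10 * x0 + e01 * y0) α hirr hα ?_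
  intro x y
  have h12 : F.a12 = -2 * F.a04 * m0 + β * (-2 * F.a04 * m1) := by rw [← hm0, ← hm1]; ring
  have h21 : F.a21 = β * (-2 * F.a04 * m0) + γ * (-2 * F.a04 * m1) := by rw [← hm0, ← hm1]; linarith
  have h30 : F.a30 = γ * (-2 * F.a04 * m0) := by rw [← hm0]; linarith
  rw [hev, h30, h21, h12, hm1, he20, he11, he02, he10, he01, hQ0, hm0d, hm1d]
  push_cast
  ring

end

lemma Q4.main (F : Q4) (hF : F.NN) : GoodSet F.vals := by
  by_cases h04 : F.a04 = 0
  · exact caseI0 F hF h04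
  by_cases hr : ∃ ρ : ℚ, F.a40 + F.a31 * ρ + F.a22 * ρ ^ 2 + F.a13 * ρ ^ 3 + F.a04 * ρ ^ 4 = 0
  · obtain ⟨ρ, hρ⟩ := hr
    exact caseI F hF ρ hρ
  have hpos : 0 < F.a04 := by
    have h := F.F4_nonneg hF 0 1
    norm_num at h
    exact lt_of_le_of_ne h (Ne.symm h04)
  by_cases hz : ∃ α : ℝ, F.f4 α = 0
  · obtain ⟨α, hα⟩ := hz
    obtain ⟨β, γ, h1, h2, h3, h4, h5, h6⟩ := double_root F hpos (F.f4_nonneg hF) (fun ρ h => hr ⟨ρ, h⟩) α hα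
    exact (caseII2 F hF hpos β γ α h2 h1 h3 h4 h5 h6).good
  · exact (caseII1 F hF hpos (fun s => lt_of_le_of_ne (F.f4_nonneg hF s) (fun h => hz ⟨s, h.symm⟩))).good

/-- the coefficient vector of a quartic polynomial -/
noncomputable def Q4.of (F : MvPolynomial (Fin 2) ℚ) : Q4 :=
  let c : ℕ → ℕ → ℚ := fun i j => F.coeff (Finsupp.single 0 i + Finsupp.single 1 j)
  ⟨c 0 0, c 1 0, c 0 1, c 2 0, c 1 1, c 0 2, c 3 0, c 2 1, c 1 2, c 0 3, c 4 0, c 3 1, c 2 2, c 1 3, c 0 4⟩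

lemma Q4.of_eval (F : MvPolynomial (Fin 2) ℚ) (hdeg : F.totalDegree ≤ 4) (x y : ℚ) :
    ((MvPolynomial.eval ![x, y] F : ℚ) : ℝ) = (Q4.of F).ev x y := by
  have key : MvPolynomial.eval ![x, y] F = ∑ p ∈ (Finset.range 5).biUnion (fun n => Finset.HasAntidiagonal.antidiagonal n),
      F.coeff (Finsupp.single 0 p.1 + Finsupp.single 1 p.2) * (x ^ p.1 * y ^ p.2) := by
    rw [MvPolynomial.eval_eq']
    have hd : ∀ d : Fin 2 →₀ ℕ, Finsupp.single 0 (d 0) + Finsupp.single 1 (d 1) = d := by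
      intro d; ext i; fin_cases i <;> simp
    refine Finset.sum_of_injOn (fun d => (d 0, d 1)) ?_ ?_ ?_ ?_
    · intro a _ b _ hab
      have h : (a 0, a 1) = (b 0, b 1) := hab
      rw [← hd a, ← hd b, (Prod.mk.inj h).1, (Prod.mk.inj h).2]
    · intro d hmem
      have h1 := MvPolynomial.le_totalDegree (Finset.mem_coe.1 hmem)
      rw [Finsupp.sum_fintype _ _ (fun _ => rfl), Fin.sum_univ_two] at h1
      simp only [Finset.coe_biUnion, Set.mem_iUnion, Finset.mem_coe, Finset.mem_range, Finset.HasAntidiagonal.mem_antidiagonal]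
      exact ⟨d 0 + d 1, by omega, rfl⟩
    · intro p _ hp
      rw [MvPolynomial.notMem_support_iff.1, zero_mul]
      intro hmem
      exact hp ⟨_, hmem, by simp⟩
    · intro d _
      simp only [hd, Fin.prod_univ_two]
      simp
  rw [key, Finset.sum_biUnion (by
    intro i _ j _ hij
    rw [Function.onFun, Finset.disjoint_left]
    intro p h1 h2
    rw [Finset.HasAntidiagonal.mem_antidiagonal] at h1 h2
    exact hij (h1.symm.trans h2))]
  simp only [Finset.sum_range_succ, Finset.Nat.sum_antidiagonal_eq_sum_range_succ_mk, Finset.sum_range_zero]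
  simp only [Q4.of, Q4.ev]
  push_cast
  norm_num
  ring

/-- If `F ∈ ℚ[x,y]` has total degree 4, is irreducible over `ℚ`,
and `F(ℤ²) ⊆ ℤ_{≥0}`, then `#ℛ_F([1,N]) ≪ N / √(log N)`. -/
theorem quartic_irreducible_value_density
    (F : MvPolynomial (Fin 2) ℚ) (hdeg : F.totalDegree = 4) (hirr : Irreducible F)
    (hsub : ∀ x y : ℤ, ∃ n : ℕ, MvPolynomial.eval ![(x : ℚ), (y : ℚ)] F = (n : ℚ)) :
    ∃ c : ℝ, 0 < c ∧ ∀ᶠ N : ℕ in Filter.atTop,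
      ({m : ℤ | 1 ≤ m ∧ m ≤ (N : ℤ) ∧
          ∃ x y : ℤ, MvPolynomial.eval ![(x : ℚ), (y : ℚ)] F = (m : ℚ)}.ncard : ℝ)
        ≤ c * N / Real.sqrt (Real.log N) := by
  have hev : ∀ x y : ℤ, ((MvPolynomial.eval ![(x:ℚ), (y:ℚ)] F : ℚ) : ℝ) = (Q4.of F).ev x y := by
    intro x y
    rw [Q4.of_eval F hdeg.le]; push_cast; rfl
  have hNN : (Q4.of F).NN := by
    intro x y
    obtain ⟨n, hn⟩ := hsub x y
    rw [← hev, hn]; push_cast; positivity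
  obtain ⟨C, hC, h⟩ := (Q4.of F).main hNN
  refine ⟨C, hC, ?_⟩
  filter_upwards [Filter.eventually_ge_atTop 2] with N hN
  have h1 := h N (by omega)
  have hl : 0 < Real.log N := Real.log_pos (by exact_mod_cast hN)
  have e : {m : ℤ | 1 ≤ m ∧ m ≤ (N : ℤ) ∧ ∃ x y : ℤ, MvPolynomial.eval ![(x : ℚ), (y : ℚ)] F = (m : ℚ)}
      = {m ∈ (Q4.of F).vals | 1 ≤ m ∧ m ≤ (N:ℤ)} := by
    ext m
    simp only [Set.mem_ofPred_eq, Q4.vals]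
    constructor
    · rintro ⟨h1, h2, x, y, h3⟩
      exact ⟨⟨x, y, by rw [← hev, h3]; push_cast; rfl⟩, h1, h2⟩
    · rintro ⟨⟨x, y, h3⟩, h1, h2⟩
      refine ⟨h1, h2, x, y, ?_⟩
      rw [← hev] at h3
      exact_mod_cast h3
  rw [e]
  refine h1.trans ?_
  rw [mul_div_assoc]
  gcongr
  linarith
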